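/- arXiv:2207.09921 — 4 statements merged into one kernel-verified Lean document; each statement's English description precedes it below -/
import Mathlib

section
/- Let σ1, σ2 > 0, ρ ∈ (−1,1), and let m, n be odd integers with m > 2 and n > 2. Then E[|X1|^m · |X2|^n] − E[|X1|^m]·E[|X2|^n] ≥ (m−1)!! (n−1)!! m n σ1^m σ2^n ρ² / π. -/
open MeasureTheory Real

/-- Centered bivariate Gaussian density with variances σ₁², σ₂² and correlation ρ. -/
noncomputable def gaussDensity2 (σ₁ σ₂ ρ x y : ℝ) : ℝ :=
  (2 * π * σ₁ * σ₂ * Real.sqrt (1 - ρ ^ 2))⁻¹ *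
    Real.exp (-(x ^ 2 / σ₁ ^ 2 - 2 * ρ * x * y / (σ₁ * σ₂) + y ^ 2 / σ₂ ^ 2) /
      (2 * (1 - ρ ^ 2)))

/-- E[|X₁|^a |X₂|^b] for the centered bivariate Gaussian. -/
noncomputable def E2 (σ₁ σ₂ ρ a b : ℝ) : ℝ :=
  ∫ q : ℝ × ℝ, |q.1| ^ a * |q.2| ^ b * gaussDensity2 σ₁ σ₂ ρ q.1 q.2

/-- E[|X|^a] for a centered Gaussian with variance σ². -/
noncomputable def E1 (σ a : ℝ) : ℝ :=
  ∫ x : ℝ, |x| ^ a * (Real.sqrt (2 * π * σ ^ 2))⁻¹ * Real.exp (-x ^ 2 / (2 * σ ^ 2))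

/-- Ratio of consecutive coefficients of the binomial series of `(1 - x) ^ (-c)`. -/
lemma multichoose_succ_mul (c : ℝ) (k : ℕ) :
    (k + 1) * Ring.multichoose c (k + 1) = (c + k) * Ring.multichoose c k := by
  have h₀ := Ring.factorial_nsmul_multichoose_eq_ascPochhammer c k
  have h₁ := Ring.factorial_nsmul_multichoose_eq_ascPochhammer c (k + 1)
  rw [Polynomial.ascPochhammer_smeval_eq_eval] at h₀ h₁
  rw [ascPochhammer_succ_eval, ← h₀] at h₁
  simp only [nsmul_eq_mul, Nat.factorial_succ, Nat.cast_mul, Nat.cast_add, Nat.cast_one] at h₁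
  have hk : (k.factorial : ℝ) ≠ 0 := by positivity
  apply mul_left_cancel₀ hk
  linear_combination h₁

lemma hasSum_multichoose_mul_pow (c : ℝ) {r : ℝ} (hr₀ : 0 ≤ r) (hr₁ : r < 1) :
    HasSum (fun k : ℕ => Ring.multichoose c k * r ^ k) ((1 - r) ^ (-c)) := by
  have h := (Real.one_div_one_sub_rpow_hasFPowerSeriesOnBall_zero c).hasSum (y := r)
    (by simp [enorm_eq_nnnorm, ← NNReal.coe_lt_coe, abs_of_nonneg hr₀, hr₁])
  simpa [FormalMultilinearSeries.ofScalars_apply_eq, Ring.multichoose_eq,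
    rpow_neg (sub_nonneg.2 hr₁.le), mul_comm] using h

/-- A hypergeometric series `T 0 * ₂F₁(a, b; 1/2; r)` dominates, coefficient by coefficient,
`T 0 * (1 + (2a - 1)(2b - 1) r / 2) * (1 - r) ^ (-(a + b - 1/2))`. -/
lemma le_of_hasSum_hypergeometric {a b r S : ℝ} {T : ℕ → ℝ} (ha : 3 / 2 ≤ a) (hb : 3 / 2 ≤ b)
    (hr₀ : 0 ≤ r) (hr₁ : r < 1) (hT₀ : 0 ≤ T 0)
    (hT : ∀ k : ℕ, (k + 1 / 2) * (k + 1) * T (k + 1) = r * ((a + k) * (b + k)) * T k)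
    (hS : HasSum T S) :
    T 0 * (1 + (2 * a - 1) * (2 * b - 1) / 2 * r) * (1 - r) ^ (-(a + b - 1 / 2)) ≤ S := by
  set c := a + b - 1 / 2 with hc
  set κ := (2 * a - 1) * (2 * b - 1) / 2 with hκ
  have hκ₀ : 0 ≤ κ := by
    have : 0 ≤ (2 * a - 1) * (2 * b - 1) := mul_nonneg (by linarith) (by linarith)
    positivity
  have hw := hasSum_multichoose_mul_pow c hr₀ hr₁
  have hwpos (k : ℕ) : 0 ≤ Ring.multichoose c k := by
    induction k with
    | zero => simp
    | succ k ih =>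
      have h := multichoose_succ_mul c k
      have hck : 0 ≤ c + k := by linarith [Nat.cast_nonneg (α := ℝ) k]
      exact nonneg_of_mul_nonneg_right (h ▸ mul_nonneg hck ih) (by positivity)
  have key (k : ℕ) : T 0 * r ^ (k + 1) * Ring.multichoose c k * (c + k + κ * (k + 1)) ≤
      (k + 1) * T (k + 1) := by
    induction k with
    | zero =>
      have h := hT 0
      simp only [Nat.cast_zero, zero_add, add_zero] at h
      simp only [Ring.multichoose_zero_right, Nat.cast_zero, zero_add, pow_one]
      rw [hκ, hc]
      apply le_of_eq
      linear_combination -2 * h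
    | succ k ih =>
      have h := hT (k + 1)
      have hm := multichoose_succ_mul c k
      push_cast at h ⊢
      have hk : (0 : ℝ) ≤ k := Nat.cast_nonneg k
      have hpoly : (c + k) * (c + (k + 1) + κ * (k + 1 + 1)) * (k + 1 + 1 / 2) ≤
          (a + (k + 1)) * (b + (k + 1)) * (c + k + κ * (k + 1)) := by
        have hD : 0 ≤ 2 * ((a - 1 / 2) * (a - 3 / 2) * ((b - 1 / 2) * (b - 3 / 2))) * (k + 1) := by
          have := mul_nonneg (show 0 ≤ a - 1 / 2 by linarith) (show 0 ≤ a - 3 / 2 by linarith)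
          have := mul_nonneg (show 0 ≤ b - 1 / 2 by linarith) (show 0 ≤ b - 3 / 2 by linarith)
          positivity
        rw [hκ, hc]
        linarith
      have hpos : (0 : ℝ) < (k + 1 + 1 / 2) * (k + 1) := by positivity
      refine le_of_mul_le_mul_left ?_ hpos
      have hab : 0 ≤ r * ((a + (k + 1)) * (b + (k + 1))) :=
        mul_nonneg hr₀ (mul_nonneg (by linarith) (by linarith))
      calc (k + 1 + 1 / 2) * (k + 1) * (T 0 * r ^ (k + 1 + 1) * Ring.multichoose c (k + 1) *
            (c + (k + 1) + κ * (k + 1 + 1)))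
          = T 0 * r ^ (k + 2) * Ring.multichoose c k *
            ((c + k) * (c + (k + 1) + κ * (k + 1 + 1)) * (k + 1 + 1 / 2)) := by
            linear_combination T 0 * r ^ (k + 2) * (c + (k + 1) + κ * (k + 1 + 1)) *
              (k + 1 + 1 / 2) * hm
        _ ≤ T 0 * r ^ (k + 2) * Ring.multichoose c k *
            ((a + (k + 1)) * (b + (k + 1)) * (c + k + κ * (k + 1))) :=
            mul_le_mul_of_nonneg_left hpoly
              (mul_nonneg (mul_nonneg hT₀ (pow_nonneg hr₀ _)) (hwpos k))
        _ = r * ((a + (k + 1)) * (b + (k + 1))) *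
            (T 0 * r ^ (k + 1) * Ring.multichoose c k * (c + k + κ * (k + 1))) := by ring
        _ ≤ r * ((a + (k + 1)) * (b + (k + 1))) * ((k + 1) * T (k + 1)) :=
            mul_le_mul_of_nonneg_left ih hab
        _ = _ := by linear_combination -(k + 1 : ℝ) * h
  have hw' := (hasSum_nat_add_iff' 1).2 hw
  have hS' := (hasSum_nat_add_iff' 1).2 hS
  simp only [Finset.range_one, Finset.sum_singleton, Ring.multichoose_zero_right, pow_zero,
    mul_one] at hw' hS'
  have hle := hasSum_le (fun k => ?_) ((hw'.add (hw.mul_left (κ * r))).mul_left (T 0)) hS'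
  · linarith
  · have hm := multichoose_succ_mul c k
    have hk : (0 : ℝ) < k + 1 := by positivity
    refine le_of_mul_le_mul_left (le_trans (le_of_eq ?_) (key k)) hk
    linear_combination T 0 * r ^ (k + 1) * hm

/-- The unnormalised absolute moment `∫ |x| ^ p exp (-α x²)`. -/
noncomputable def absMoment (α : ℝ) (p : ℕ) : ℝ := ∫ x : ℝ, |x| ^ p * exp (-α * x ^ 2)

lemma absMoment_eq {α : ℝ} (hα : 0 < α) (p : ℕ) :
    absMoment α p = α ^ (-((p : ℝ) + 1) / 2) * Gamma (((p : ℝ) + 1) / 2) := by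
  have h₁ := integral_comp_abs (f := fun x : ℝ => x ^ p * exp (-α * x ^ 2))
  simp only [sq_abs] at h₁
  have h₂ := integral_rpow_mul_exp_neg_mul_rpow (p := 2) (q := p) two_pos
    (by linarith [Nat.cast_nonneg (α := ℝ) p]) hα
  simp only [rpow_natCast, rpow_two] at h₂
  rw [absMoment, h₁, h₂]
  ring

lemma absMoment_nonneg (α : ℝ) (p : ℕ) : 0 ≤ absMoment α p :=
  integral_nonneg fun x => by positivity

lemma absMoment_add_two {α : ℝ} (hα : 0 < α) (p : ℕ) :
    2 * α * absMoment α (p + 2) = (p + 1) * absMoment α p := by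
  rw [absMoment_eq hα, absMoment_eq hα]
  have hΓ := Real.Gamma_add_one (s := ((p : ℝ) + 1) / 2) (by positivity)
  have e₁ : (((p + 2 : ℕ) : ℝ) + 1) / 2 = ((p : ℝ) + 1) / 2 + 1 := by push_cast; ring
  have e₂ : -(((p + 2 : ℕ) : ℝ) + 1) / 2 = -((p : ℝ) + 1) / 2 - 1 := by push_cast; ring
  rw [e₁, e₂, hΓ, rpow_sub_one hα.ne']
  field_simp

lemma integrable_pow_mul_abs_pow_mul_exp {α : ℝ} (hα : 0 < α) (p k : ℕ) :
    Integrable fun x : ℝ => x ^ k * |x| ^ p * exp (-α * x ^ 2) := by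
  have h := integrable_rpow_mul_exp_neg_mul_sq hα (s := (k + p : ℕ))
    (by linarith [Nat.cast_nonneg (α := ℝ) (k + p)])
  refine h.mono (by fun_prop) (ae_of_all _ fun x => le_of_eq ?_)
  simp only [norm_mul, rpow_natCast, pow_add, norm_pow, norm_eq_abs, abs_abs]

lemma integral_odd_pow_mul_abs_pow_mul_exp (α : ℝ) (p k : ℕ) :
    ∫ x : ℝ, x ^ (2 * k + 1) * |x| ^ p * exp (-α * x ^ 2) = 0 := by
  have h := integral_neg_eq_self (fun x : ℝ => x ^ (2 * k + 1) * |x| ^ p * exp (-α * x ^ 2)) volume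
  have hodd (x : ℝ) : (-x) ^ (2 * k + 1) = -x ^ (2 * k + 1) := Odd.neg_pow ⟨k, rfl⟩ x
  simp only [hodd, abs_neg, neg_sq, neg_mul, integral_neg] at h ⊢
  linarith

lemma integral_even_pow_mul_abs_pow_mul_exp (α : ℝ) (p k : ℕ) :
    ∫ x : ℝ, x ^ (2 * k) * |x| ^ p * exp (-α * x ^ 2) = absMoment α (p + 2 * k) := by
  refine integral_congr_ae (ae_of_all _ fun x => ?_)
  simp only [pow_add, ← (even_two_mul k).pow_abs x]
  ring

/-- Ratio test along steps of length two. -/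
lemma summable_of_step_two {t w : ℕ → ℝ} {l : ℝ} (hl : |l| < 1)
    (hw : Filter.Tendsto w Filter.atTop (nhds l)) (ht : ∀ k, t (k + 2) = w k * t k) :
    Summable t := by
  obtain ⟨q, hlq, hq⟩ := exists_between hl
  have hev : ∀ᶠ k in Filter.atTop, |w k| ≤ q := (hw.abs.eventually_lt_const hlq).mono
    fun _ h => h.le
  have hsub {φ : ℕ → ℕ} (hφ : Filter.Tendsto φ Filter.atTop Filter.atTop)
      (hφ₂ : ∀ k, φ (k + 1) = φ k + 2) : Summable fun k => t (φ k) := by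
    refine summable_of_ratio_norm_eventually_le hq ((hφ.eventually hev).mono fun k hk => ?_)
    rw [hφ₂, ht, norm_mul]
    exact mul_le_mul_of_nonneg_right hk (norm_nonneg _)
  have he : Summable fun k => t (2 * k) :=
    hsub (Filter.tendsto_atTop_mono (fun k => by dsimp only [id]; lia) Filter.tendsto_id)
      fun k => by ring
  have ho : Summable fun k => t (2 * k + 1) :=
    hsub (Filter.tendsto_atTop_mono (fun k => by dsimp only [id]; lia) Filter.tendsto_id)
      fun k => by ring
  exact (he.hasSum.even_add_odd ho.hasSum).summable

lemma hasSum_integral_gaussian_prod {α β γ : ℝ} (hα : 0 < α) (hβ : 0 < β)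
    (hγ : γ ^ 2 < 4 * (α * β)) (m n : ℕ) :
    HasSum (fun k : ℕ => γ ^ (2 * k) / (2 * k).factorial *
        (absMoment α (m + 2 * k) * absMoment β (n + 2 * k)))
      (∫ q : ℝ × ℝ, |q.1| ^ m * |q.2| ^ n *
        exp (-α * q.1 ^ 2 + -β * q.2 ^ 2 + γ * (q.1 * q.2))) := by
  let F (k : ℕ) (q : ℝ × ℝ) : ℝ := γ ^ k / k.factorial *
    ((q.1 ^ k * |q.1| ^ m * exp (-α * q.1 ^ 2)) * (q.2 ^ k * |q.2| ^ n * exp (-β * q.2 ^ 2)))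
  have hFint (k : ℕ) : Integrable (F k) :=
    ((integrable_pow_mul_abs_pow_mul_exp hα m k).mul_prod
      (integrable_pow_mul_abs_pow_mul_exp hβ n k)).const_mul _
  have hF (k : ℕ) : ∫ q, F k q = γ ^ k / k.factorial *
      ((∫ x : ℝ, x ^ k * |x| ^ m * exp (-α * x ^ 2)) *
        ∫ x : ℝ, x ^ k * |x| ^ n * exp (-β * x ^ 2)) := by
    rw [← integral_prod_mul, ← integral_const_mul]
    rfl
  have hFnorm (k : ℕ) : ∫ q, ‖F k q‖ =
      |γ| ^ k / k.factorial * (absMoment α (m + k) * absMoment β (n + k)) := by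
    rw [absMoment, absMoment, ← integral_prod_mul, ← integral_const_mul]
    refine integral_congr_ae (ae_of_all _ fun q => ?_)
    simp only [F, norm_mul, norm_div, norm_pow, norm_eq_abs, abs_abs, abs_exp, Nat.abs_cast,
      pow_add]
    ring
  have hsum : Summable fun k => ∫ q, ‖F k q‖ := by
    simp only [hFnorm]
    refine summable_of_step_two (l := γ ^ 2 / (4 * (α * β)))
      (w := fun k : ℕ => γ ^ 2 / (4 * (α * β)) *
        (((m + 1 : ℝ) + 1 * k) / (1 + 1 * k) * (((n + 1 : ℝ) + 1 * k) / (2 + 1 * k)))) ?_ ?_ ?_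
    · rw [abs_of_nonneg (by positivity), div_lt_one (by positivity)]
      exact hγ
    · simpa using ((tendsto_add_mul_div_add_mul_atTop_nhds (m + 1 : ℝ) 1 1 one_ne_zero).mul
        (tendsto_add_mul_div_add_mul_atTop_nhds (n + 1 : ℝ) 2 1 one_ne_zero)).const_mul
          (γ ^ 2 / (4 * (α * β)))
    · intro k
      have h₁ := absMoment_add_two hα (m + k)
      have h₂ := absMoment_add_two hβ (n + k)
      have e₁ : absMoment α (m + (k + 2)) = (m + k + 1) * absMoment α (m + k) / (2 * α) := by
        rw [eq_div_iff (by positivity), ← add_assoc]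
        push_cast at h₁
        linarith
      have e₂ : absMoment β (n + (k + 2)) = (n + k + 1) * absMoment β (n + k) / (2 * β) := by
        rw [eq_div_iff (by positivity), ← add_assoc]
        push_cast at h₂
        linarith
      rw [e₁, e₂, pow_add, sq_abs, Nat.factorial_succ, Nat.factorial_succ]
      push_cast
      have : (k.factorial : ℝ) ≠ 0 := by positivity
      field_simp
      ring
  have h := hasSum_integral_of_summable_integral_norm hFint hsum
  have hexp (q : ℝ × ℝ) : ∑' k, F k q = |q.1| ^ m * |q.2| ^ n *
      exp (-α * q.1 ^ 2 + -β * q.2 ^ 2 + γ * (q.1 * q.2)) := by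
    have h₀ := (NormedSpace.expSeries_div_hasSum_exp (γ * (q.1 * q.2))).mul_left
      (|q.1| ^ m * |q.2| ^ n * (exp (-α * q.1 ^ 2) * exp (-β * q.2 ^ 2)))
    rw [← Real.exp_eq_exp_ℝ] at h₀
    rw [exp_add, exp_add, ← mul_assoc, ← h₀.tsum_eq]
    refine tsum_congr fun k => ?_
    simp only [F, mul_pow]
    ring
  simp only [hexp] at h
  have hinj : Function.Injective fun k : ℕ => 2 * k := fun _ _ h => by simpa using h
  rw [← hinj.hasSum_iff] at h
  · simpa only [Function.comp_def, hF, integral_even_pow_mul_abs_pow_mul_exp] using h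
  · intro k hk
    rcases Nat.even_or_odd' k with ⟨j, rfl | rfl⟩
    · exact (hk ⟨j, rfl⟩).elim
    · rw [hF, integral_odd_pow_mul_abs_pow_mul_exp, zero_mul, mul_zero]

lemma absMoment_odd {α : ℝ} (hα : 0 < α) (j : ℕ) :
    absMoment α (2 * j + 1) = α⁻¹ ^ (j + 1) * j.factorial := by
  have e : (((2 * j + 1 : ℕ) : ℝ) + 1) / 2 = (j : ℝ) + 1 := by push_cast; ring
  rw [absMoment_eq hα, neg_div, e, Real.Gamma_nat_eq_factorial, rpow_neg hα.le, inv_pow]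
  norm_cast

lemma E1_odd {σ : ℝ} (hσ : 0 < σ) (j : ℕ) :
    E1 σ ((2 * j + 1 : ℕ) : ℝ) =
      (√(2 * π))⁻¹ * σ⁻¹ * ((2 * σ ^ 2) ^ (j + 1) * j.factorial) := by
  have h := absMoment_odd (α := (2 * σ ^ 2)⁻¹) (by positivity) j
  rw [inv_inv] at h
  rw [E1, ← h, absMoment, ← integral_const_mul]
  refine integral_congr_ae (ae_of_all _ fun x => ?_)
  have hexp : -x ^ 2 / (2 * σ ^ 2) = -(2 * σ ^ 2)⁻¹ * x ^ 2 := by ring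
  simp only [rpow_natCast]
  rw [hexp, sqrt_mul (by positivity), sqrt_sq hσ.le, mul_inv]
  ring

lemma E2_eq {σ₁ σ₂ ρ : ℝ} (hσ₁ : 0 < σ₁) (hσ₂ : 0 < σ₂) (hρ : 0 < 1 - ρ ^ 2) (m n : ℕ) :
    E2 σ₁ σ₂ ρ m n = (2 * π * σ₁ * σ₂ * √(1 - ρ ^ 2))⁻¹ *
      ∫ q : ℝ × ℝ, |q.1| ^ m * |q.2| ^ n *
        exp (-(2 * σ₁ ^ 2 * (1 - ρ ^ 2))⁻¹ * q.1 ^ 2 + -(2 * σ₂ ^ 2 * (1 - ρ ^ 2))⁻¹ * q.2 ^ 2 +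
          ρ / (σ₁ * σ₂ * (1 - ρ ^ 2)) * (q.1 * q.2)) := by
  rw [E2, ← integral_const_mul]
  refine integral_congr_ae (ae_of_all _ fun q => ?_)
  have hexp : -(q.1 ^ 2 / σ₁ ^ 2 - 2 * ρ * q.1 * q.2 / (σ₁ * σ₂) + q.2 ^ 2 / σ₂ ^ 2) /
      (2 * (1 - ρ ^ 2)) =
      -(2 * σ₁ ^ 2 * (1 - ρ ^ 2))⁻¹ * q.1 ^ 2 + -(2 * σ₂ ^ 2 * (1 - ρ ^ 2))⁻¹ * q.2 ^ 2 +
        ρ / (σ₁ * σ₂ * (1 - ρ ^ 2)) * (q.1 * q.2) := by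
    have := hρ.ne'
    field_simp
    ring
  simp only [gaussDensity2, rpow_natCast]
  rw [hexp]
  ring

lemma E1_mul_E1_le_E2_odd {σ₁ σ₂ ρ : ℝ} (hσ₁ : 0 < σ₁) (hσ₂ : 0 < σ₂) (hρ : 0 < 1 - ρ ^ 2)
    {i j : ℕ} (hi : 1 ≤ i) (hj : 1 ≤ j) :
    E1 σ₁ ((2 * i + 1 : ℕ) : ℝ) * E1 σ₂ ((2 * j + 1 : ℕ) : ℝ) *
        (1 + (2 * i + 1) * (2 * j + 1) / 2 * ρ ^ 2) ≤
      E2 σ₁ σ₂ ρ ((2 * i + 1 : ℕ) : ℝ) ((2 * j + 1 : ℕ) : ℝ) := by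
  set v := 1 - ρ ^ 2 with hv
  set α := (2 * σ₁ ^ 2 * v)⁻¹ with hα
  set β := (2 * σ₂ ^ 2 * v)⁻¹ with hβ
  set γ := ρ / (σ₁ * σ₂ * v) with hγ
  have hα₀ : 0 < α := by positivity
  have hβ₀ : 0 < β := by positivity
  have hγ₂ : γ ^ 2 = ρ ^ 2 * (4 * (α * β)) := by
    rw [hα, hβ, hγ]
    field_simp
    ring
  have hρ₁ : ρ ^ 2 < 1 := by linarith
  have hsum := hasSum_integral_gaussian_prod hα₀ hβ₀ (γ := γ)
    (by rw [hγ₂]; nlinarith [mul_pos hα₀ hβ₀]) (2 * i + 1) (2 * j + 1)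
  have hi' : (1 : ℝ) ≤ i := by exact_mod_cast hi
  have hj' : (1 : ℝ) ≤ j := by exact_mod_cast hj
  have hle := le_of_hasSum_hypergeometric (a := i + 1) (b := j + 1) (r := ρ ^ 2)
    (by linarith) (by linarith) (sq_nonneg ρ) hρ₁ ?_ ?_ hsum
  · rw [E2_eq hσ₁ hσ₂ hρ, E1_odd hσ₁, E1_odd hσ₂]
    refine le_trans (le_of_eq ?_) (mul_le_mul_of_nonneg_left hle (by positivity))
    have hpow : v ^ (-((i : ℝ) + 1 + (j + 1) - 1 / 2)) = √v * (v ^ (i + 1 + (j + 1)))⁻¹ := by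
      rw [sqrt_eq_rpow, ← rpow_natCast, ← rpow_neg hρ.le, ← rpow_add hρ]
      congr 1
      push_cast
      ring
    have hπ : √(2 * π) * √(2 * π) = 2 * π := mul_self_sqrt (by positivity)
    have hinv : (√(2 * π))⁻¹ * (√(2 * π))⁻¹ = (2 * π)⁻¹ := by rw [← mul_inv, hπ]
    simp only [mul_zero, pow_zero, Nat.factorial_zero, Nat.cast_one, div_one, one_mul, add_zero]
    rw [absMoment_odd hα₀, absMoment_odd hβ₀, ← hv, hpow, hα, hβ, inv_inv, inv_inv,
      mul_pow _ v, mul_pow _ v, pow_add v]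
    have hsv : √v ≠ 0 := (sqrt_pos.2 hρ).ne'
    generalize √v = s at hsv ⊢
    calc _ = ((√(2 * π))⁻¹ * (√(2 * π))⁻¹) * (σ₁⁻¹ * σ₂⁻¹ *
          ((2 * σ₁ ^ 2) ^ (i + 1) * i.factorial * ((2 * σ₂ ^ 2) ^ (j + 1) * j.factorial)) *
          (1 + (2 * i + 1) * (2 * j + 1) / 2 * ρ ^ 2)) := by ring
      _ = _ := by
        rw [hinv]
        field_simp
        ring
  · have := absMoment_nonneg α (2 * i + 1 + 2 * 0)
    have := absMoment_nonneg β (2 * j + 1 + 2 * 0)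
    simp only [mul_zero, pow_zero]
    positivity
  · intro k
    have h₁ := absMoment_add_two hα₀ (2 * i + 1 + 2 * k)
    have h₂ := absMoment_add_two hβ₀ (2 * j + 1 + 2 * k)
    have hfac : ((2 * (k + 1)).factorial : ℝ) =
        4 * ((k + 1 / 2) * (k + 1)) * (2 * k).factorial := by
      rw [show 2 * (k + 1) = 2 * k + 1 + 1 by ring, Nat.factorial_succ, Nat.factorial_succ]
      push_cast
      ring
    have hk : ((2 * k).factorial : ℝ) ≠ 0 := by positivity
    rw [show 2 * i + 1 + 2 * (k + 1) = 2 * i + 1 + 2 * k + 2 by ring,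
      show 2 * j + 1 + 2 * (k + 1) = 2 * j + 1 + 2 * k + 2 by ring, hfac, mul_add 2 k 1, mul_one,
      pow_add γ, hγ₂]
    push_cast at h₁ h₂
    clear_value α β γ
    field_simp
    linear_combination ρ ^ 2 * γ ^ (2 * k) / 4 *
      ((2 * β * absMoment β (2 * j + 1 + 2 * k + 2)) * h₁ +
        (2 * i + 1 + 2 * k + 1) * absMoment α (2 * i + 1 + 2 * k) * h₂)

theorem gpi_quantitative_odd_odd (σ₁ σ₂ ρ : ℝ) (m n : ℕ)
    (hσ₁ : 0 < σ₁) (hσ₂ : 0 < σ₂) (hρ : ρ ∈ Set.Ioo (-1 : ℝ) 1)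
    (hm : 2 < m) (hn : 2 < n) (hmodd : Odd m) (hnodd : Odd n) :
    E2 σ₁ σ₂ ρ (m : ℝ) (n : ℝ) - E1 σ₁ (m : ℝ) * E1 σ₂ (n : ℝ) ≥
      (Nat.doubleFactorial (m - 1) : ℝ) * (Nat.doubleFactorial (n - 1) : ℝ) *
        m * n * σ₁ ^ (m : ℝ) * σ₂ ^ (n : ℝ) * ρ ^ 2 / π := by
  obtain ⟨i, rfl⟩ := hmodd
  obtain ⟨j, rfl⟩ := hnodd
  have hv : 0 < 1 - ρ ^ 2 := by nlinarith [hρ.1, hρ.2]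
  have h := E1_mul_E1_le_E2_odd hσ₁ hσ₂ hv (i := i) (j := j) (by lia) (by lia)
  have hπ : √(2 * π) * √(2 * π) = 2 * π := mul_self_sqrt (by positivity)
  have hinv : (√(2 * π))⁻¹ * (√(2 * π))⁻¹ = (2 * π)⁻¹ := by rw [← mul_inv, hπ]
  have hE : E1 σ₁ ((2 * i + 1 : ℕ) : ℝ) * E1 σ₂ ((2 * j + 1 : ℕ) : ℝ) =
      2 * (2 ^ i * i.factorial) * (2 ^ j * j.factorial) * σ₁ ^ (2 * i + 1) * σ₂ ^ (2 * j + 1) /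
        π := by
    rw [E1_odd hσ₁, E1_odd hσ₂]
    calc _ = ((√(2 * π))⁻¹ * (√(2 * π))⁻¹) * (σ₁⁻¹ * σ₂⁻¹ * ((2 * σ₁ ^ 2) ^ (i + 1) *
          i.factorial * ((2 * σ₂ ^ 2) ^ (j + 1) * j.factorial))) := by ring
      _ = _ := by
        rw [hinv, mul_pow, mul_pow, ← pow_mul, ← pow_mul]
        field_simp
        ring
  have hrhs : (Nat.doubleFactorial (2 * i + 1 - 1) : ℝ) *
      (Nat.doubleFactorial (2 * j + 1 - 1) : ℝ) * ((2 * i + 1 : ℕ) : ℝ) * ((2 * j + 1 : ℕ) : ℝ) *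
      σ₁ ^ ((2 * i + 1 : ℕ) : ℝ) * σ₂ ^ ((2 * j + 1 : ℕ) : ℝ) * ρ ^ 2 / π =
      E1 σ₁ ((2 * i + 1 : ℕ) : ℝ) * E1 σ₂ ((2 * j + 1 : ℕ) : ℝ) *
        ((2 * i + 1) * (2 * j + 1) / 2 * ρ ^ 2) := by
    rw [hE, Nat.add_sub_cancel, Nat.add_sub_cancel, Nat.doubleFactorial_two_mul,
      Nat.doubleFactorial_two_mul, rpow_natCast, rpow_natCast]
    push_cast
    ring
  rw [hrhs]
  linarith
end

section
/- Let σ1, σ2 > 0, ρ ∈ (−1,1), and let m, n be integers with m > 2 and n > 2, one of which is odd and the other even. Then E[|X1|^m · |X2|^n] − E[|X1|^m]·E[|X2|^n] ≥ (m−1)!! (n−1)!! m n σ1^m σ2^n ρ² / √(2π). -/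
open MeasureTheory Real

open Finset in
/-- A sum whose odd-indexed terms vanish is the sum of its even-indexed terms. -/
lemma sum_range_two_mul_add_one_of_odd_eq_zero (f : ℕ → ℝ) (hf : ∀ k, Odd k → f k = 0) (N : ℕ) :
    ∑ k ∈ range (2 * N + 1), f k = ∑ j ∈ range (N + 1), f (2 * j) := by
  induction N with
  | zero => simp
  | succ N ih =>
    rw [sum_range_succ _ (N + 1), ← ih, show 2 * (N + 1) + 1 = 2 * N + 1 + 1 + 1 by ring,
      sum_range_succ, sum_range_succ, hf (2 * N + 1) ⟨N, rfl⟩]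
    ring_nf

lemma doubleFactorial_two_mul_succ_sub_one (k : ℕ) :
    (2 * (k + 1) - 1).doubleFactorial = (2 * k + 1) * (2 * k - 1).doubleFactorial := by
  rw [show 2 * (k + 1) - 1 = 2 * k + 1 by lia, Nat.doubleFactorial_add_one]

lemma doubleFactorial_mul_two_pow_mul_factorial (k : ℕ) :
    (2 * k - 1).doubleFactorial * (2 ^ k * k.factorial) = (2 * k).factorial := by
  rw [← Nat.doubleFactorial_two_mul]
  cases k with
  | zero => rfl
  | succ k =>
    rw [show 2 * (k + 1) = 2 * k + 1 + 1 by ring, Nat.factorial_eq_mul_doubleFactorial]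
    simp [mul_comm]

lemma choose_two_mul_mul_doubleFactorial {N j : ℕ} (hj : j ≤ N) :
    (2 * N).choose (2 * j) * (2 * (N - j) - 1).doubleFactorial * (2 * j - 1).doubleFactorial =
      N.choose j * (2 * N - 1).doubleFactorial := by
  obtain ⟨i, rfl⟩ := Nat.exists_eq_add_of_le' hj
  have h₁ := doubleFactorial_mul_two_pow_mul_factorial (i + j)
  have h₂ := doubleFactorial_mul_two_pow_mul_factorial i
  have h₃ := doubleFactorial_mul_two_pow_mul_factorial j
  have h₄ := Nat.add_choose_mul_factorial_mul_factorial i j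
  have h₅ := Nat.add_choose_mul_factorial_mul_factorial (2 * i) (2 * j)
  rw [Nat.add_sub_cancel]
  have hpos : 0 < 2 ^ (i + j) * i.factorial * j.factorial := by positivity
  apply Nat.eq_of_mul_eq_mul_right hpos
  rw [← h₂, ← h₃, ← mul_add, ← h₁, ← h₄] at h₅
  rw [pow_add] at h₅ ⊢
  linear_combination h₅

/-- The linear lower bound for the Bernstein coefficients `∏ (m + 2i + 1) / (2i + 1)`. -/
lemma doubleFactorial_mul_le_prod (m j : ℕ) (hm : 2 ≤ m) :
    ((2 * j - 1).doubleFactorial : ℝ) * (1 + m * j) ≤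
      ∏ i ∈ Finset.range j, ((m : ℝ) + 2 * i + 1) := by
  induction j with
  | zero => simp
  | succ j ih =>
    rw [Finset.prod_range_succ, doubleFactorial_two_mul_succ_sub_one]
    refine le_trans ?_ (mul_le_mul_of_nonneg_right ih (by positivity))
    push_cast
    have hm' : (2 : ℝ) ≤ m := by exact_mod_cast hm
    have hj : (0 : ℝ) ≤ j := by positivity
    have hle : (2 * (j : ℝ) + 1) * (1 + m * (j + 1)) ≤ (1 + m * j) * (m + 2 * j + 1) := by
      nlinarith [mul_nonneg (mul_nonneg hj (sub_nonneg.2 hm')) (zero_le_two.trans hm')]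
    calc _ = ((2 * j - 1).doubleFactorial : ℝ) * ((2 * (j : ℝ) + 1) * (1 + m * (j + 1))) := by ring
      _ ≤ (2 * j - 1).doubleFactorial * ((1 + m * j) * (m + 2 * j + 1)) := by gcongr
      _ = _ := by ring

lemma sum_choose_mul_one_add (N : ℕ) (t m : ℝ) :
    ∑ j ∈ Finset.range (N + 1), (N.choose j : ℝ) * t ^ j * (1 - t) ^ (N - j) * (1 + m * j) =
      1 + m * N * t := by
  have h₀ := congrArg (Polynomial.eval t) (bernsteinPolynomial.sum ℝ N)
  have h₁ := congrArg (Polynomial.eval t) (bernsteinPolynomial.sum_smul ℝ N)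
  simp only [bernsteinPolynomial, Polynomial.eval_finsetSum, Polynomial.eval_mul, Polynomial.eval_pow,
    Polynomial.eval_sub, Polynomial.eval_X, Polynomial.eval_one, Polynomial.eval_natCast,
    nsmul_eq_mul] at h₀ h₁
  rw [mul_assoc, ← h₁, Finset.mul_sum]
  refine Eq.trans ?_ (congrArg (· + _) h₀)
  rw [← Finset.sum_add_distrib]
  exact Finset.sum_congr rfl fun j _ => by ring

/-- Centered Gaussian density on the line with standard deviation `σ`. -/
noncomputable def gaussDensity1 (σ x : ℝ) : ℝ :=
  (√(2 * π * σ ^ 2))⁻¹ * exp (-x ^ 2 / (2 * σ ^ 2))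

lemma gaussDensity1_nonneg (σ x : ℝ) : 0 ≤ gaussDensity1 σ x := by
  unfold gaussDensity1; positivity

lemma measurable_gaussDensity1 (σ : ℝ) : Measurable (gaussDensity1 σ) := by
  unfold gaussDensity1; fun_prop

lemma gaussDensity1_neg (σ x : ℝ) : gaussDensity1 σ (-x) = gaussDensity1 σ x := by
  simp [gaussDensity1]

lemma E1_natCast (σ : ℝ) (k : ℕ) : E1 σ k = ∫ x, |x| ^ k * gaussDensity1 σ x := by
  simp only [E1, gaussDensity1, rpow_natCast, mul_assoc]

lemma integrable_pow_mul_gaussDensity1 {σ : ℝ} (hσ : 0 < σ) (k : ℕ) :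
    Integrable fun x : ℝ => x ^ k * gaussDensity1 σ x := by
  have hb : 0 < 1 / (2 * σ ^ 2) := by positivity
  have hk : (-1 : ℝ) < k := by linarith [k.cast_nonneg (α := ℝ)]
  refine ((integrable_rpow_mul_exp_neg_mul_sq hb hk).mul_const (√(2 * π * σ ^ 2))⁻¹).congr
    (.of_forall fun x => ?_)
  simp only [gaussDensity1, rpow_natCast]
  ring_nf

lemma integrable_abs_pow_mul_gaussDensity1 {σ : ℝ} (hσ : 0 < σ) (k : ℕ) :
    Integrable fun x : ℝ => |x| ^ k * gaussDensity1 σ x := by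
  refine (integrable_pow_mul_gaussDensity1 hσ k).norm.congr (.of_forall fun x => ?_)
  simp [abs_of_nonneg (gaussDensity1_nonneg σ x)]

lemma E1_eq_Gamma {σ : ℝ} (hσ : 0 < σ) (k : ℕ) :
    E1 σ k = σ ^ k * √2 ^ k * Gamma ((k + 1) / 2) / √π := by
  have hb : 0 < 1 / (2 * σ ^ 2) := by positivity
  have hk : (-1 : ℝ) < k := by linarith [k.cast_nonneg (α := ℝ)]
  have h := integral_comp_abs (f := fun x : ℝ => x ^ (k : ℝ) * exp (-(1 / (2 * σ ^ 2)) * x ^ (2 : ℝ)))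
  rw [integral_rpow_mul_exp_neg_mul_rpow two_pos hk hb] at h
  have h₁ : E1 σ k = (√(2 * π * σ ^ 2))⁻¹ *
      ∫ x : ℝ, |x| ^ (k : ℝ) * exp (-(1 / (2 * σ ^ 2)) * |x| ^ (2 : ℝ)) := by
    rw [E1, ← integral_const_mul]
    refine integral_congr_ae (.of_forall fun x => ?_)
    simp only [rpow_two, sq_abs]
    ring_nf
  have h₂ : (1 / (2 * σ ^ 2)) ^ (-((k : ℝ) + 1) / 2) = (√2 * σ) ^ (k + 1) := by
    rw [one_div, show 2 * σ ^ 2 = (√2 * σ) ^ 2 by rw [mul_pow, sq_sqrt zero_le_two],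
      ← rpow_natCast _ 2, ← rpow_neg (by positivity), ← rpow_mul (by positivity), ← rpow_natCast]
    congr 1
    push_cast
    ring
  rw [h₁, h, h₂, sqrt_mul (by positivity), sqrt_mul zero_le_two, sqrt_sq hσ.le]
  field_simp
  ring

lemma E1_add_two {σ : ℝ} (hσ : 0 < σ) (k : ℕ) :
    E1 σ (k + 2 : ℕ) = σ ^ 2 * (k + 1) * E1 σ k := by
  rw [E1_eq_Gamma hσ, E1_eq_Gamma hσ,
    show (((k + 2 : ℕ) : ℝ) + 1) / 2 = ((k : ℝ) + 1) / 2 + 1 by push_cast; ring,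
    Gamma_add_one (by positivity), pow_add √2, sq_sqrt zero_le_two]
  ring

lemma E1_two_mul {σ : ℝ} (hσ : 0 < σ) (k : ℕ) :
    E1 σ (2 * k : ℕ) = (2 * k - 1).doubleFactorial * σ ^ (2 * k) := by
  induction k with
  | zero =>
    rw [E1_eq_Gamma hσ]
    simp [Gamma_one_half_eq, -one_div, div_self (sqrt_pos.2 pi_pos).ne']
  | succ k ih =>
    rw [doubleFactorial_two_mul_succ_sub_one, mul_add, mul_one, E1_add_two hσ, ih]
    push_cast
    ring

lemma E1_two_mul_add_one {σ : ℝ} (hσ : 0 < σ) (k : ℕ) :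
    E1 σ (2 * k + 1 : ℕ) = 2 / √(2 * π) * (2 * k).doubleFactorial * σ ^ (2 * k + 1) := by
  induction k with
  | zero =>
    rw [E1_eq_Gamma hσ, sqrt_mul zero_le_two]
    have := sq_sqrt (zero_le_two (α := ℝ))
    norm_num
    field_simp
    linarith
  | succ k ih =>
    rw [show 2 * (k + 1) + 1 = 2 * k + 1 + 2 by ring, E1_add_two hσ, ih,
      show 2 * (k + 1) = 2 * k + 2 by ring, Nat.doubleFactorial_add_two]
    push_cast
    ring

lemma E1_add_two_mul {σ : ℝ} (hσ : 0 < σ) (m j : ℕ) :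
    E1 σ (m + 2 * j : ℕ) = σ ^ (2 * j) * (∏ i ∈ Finset.range j, ((m : ℝ) + 2 * i + 1)) * E1 σ m := by
  induction j with
  | zero => simp
  | succ j ih =>
    rw [mul_add, mul_one, ← add_assoc, E1_add_two hσ, ih, Finset.prod_range_succ]
    push_cast
    ring

lemma integral_odd_pow_mul_gaussDensity1 (σ : ℝ) {k : ℕ} (hk : Odd k) :
    ∫ x : ℝ, x ^ k * gaussDensity1 σ x = 0 := by
  have h := integral_neg_eq_self (fun x : ℝ => x ^ k * gaussDensity1 σ x) volume
  simp only [hk.neg_pow, gaussDensity1_neg, neg_mul, integral_neg] at h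
  linarith

lemma integral_pow_two_mul_mul_gaussDensity1 (σ : ℝ) (k : ℕ) :
    ∫ x : ℝ, x ^ (2 * k) * gaussDensity1 σ x = E1 σ (2 * k : ℕ) := by
  rw [E1_natCast]
  simp_rw [(even_two_mul k).pow_abs]

lemma add_pow_mul_gaussDensity1 (s μ y : ℝ) (N : ℕ) :
    (y + μ) ^ N * gaussDensity1 s y = ∑ k ∈ Finset.range (N + 1),
      (N.choose k : ℝ) * μ ^ k * (y ^ (N - k) * gaussDensity1 s y) := by
  rw [add_comm, add_pow, Finset.sum_mul]
  exact Finset.sum_congr rfl fun k _ => by ring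

lemma integrable_pow_mul_gaussDensity1_sub {s : ℝ} (hs : 0 < s) (μ : ℝ) (N : ℕ) :
    Integrable fun y : ℝ => y ^ N * gaussDensity1 s (y - μ) := by
  have h : Integrable fun y : ℝ => (y + μ) ^ N * gaussDensity1 s y := by
    simp_rw [add_pow_mul_gaussDensity1]
    exact integrable_finsetSum _ fun k _ => (integrable_pow_mul_gaussDensity1 hs _).const_mul _
  simpa using h.comp_sub_right μ

/-- Even moments of a Gaussian variable with mean `μ` and standard deviation `s`. -/
lemma integral_pow_two_mul_mul_gaussDensity1_sub {s : ℝ} (hs : 0 < s) (μ : ℝ) (N : ℕ) :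
    ∫ y : ℝ, y ^ (2 * N) * gaussDensity1 s (y - μ) = ∑ j ∈ Finset.range (N + 1),
      ((2 * N).choose (2 * j) : ℝ) * μ ^ (2 * j) * E1 s (2 * (N - j) : ℕ) := by
  rw [← integral_add_right_eq_self _ μ]
  simp_rw [add_sub_cancel_right, add_pow_mul_gaussDensity1]
  rw [integral_finsetSum _ fun k _ => (integrable_pow_mul_gaussDensity1 hs _).const_mul _]
  simp_rw [integral_const_mul]
  rw [Finset.sum_congr rfl (g := fun k => if Odd k then 0 else ((2 * N).choose k : ℝ) * μ ^ k *
    ∫ x : ℝ, x ^ (2 * N - k) * gaussDensity1 s x) fun k hk => ?_,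
    sum_range_two_mul_add_one_of_odd_eq_zero _ fun k hk => if_pos hk]
  · refine Finset.sum_congr rfl fun j _ => ?_
    rw [if_neg (by simp), ← Nat.mul_sub, integral_pow_two_mul_mul_gaussDensity1]
  · split_ifs with hk'
    · have hodd : Odd (2 * N - k) :=
        Nat.Even.sub_odd (by simpa [Nat.lt_succ_iff] using hk) (even_two_mul N) hk'
      rw [integral_odd_pow_mul_gaussDensity1 s hodd, mul_zero]
    · rfl

lemma gaussDensity2_eq {σ₁ σ₂ ρ : ℝ} (hσ₁ : 0 < σ₁) (hσ₂ : 0 < σ₂) (hρ : 0 < 1 - ρ ^ 2) (x y : ℝ) :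
    gaussDensity2 σ₁ σ₂ ρ x y =
      gaussDensity1 σ₁ x * gaussDensity1 (σ₂ * √(1 - ρ ^ 2)) (y - ρ * σ₂ / σ₁ * x) := by
  have hexp : -(x ^ 2 / σ₁ ^ 2 - 2 * ρ * x * y / (σ₁ * σ₂) + y ^ 2 / σ₂ ^ 2) /
      (2 * (1 - ρ ^ 2)) = -x ^ 2 / (2 * σ₁ ^ 2) +
        -(y - ρ * σ₂ / σ₁ * x) ^ 2 / (2 * (σ₂ ^ 2 * (1 - ρ ^ 2))) := by
    field_simp
    ring
  have hπ : (2 * π)⁻¹ = (√(2 * π))⁻¹ * (√(2 * π))⁻¹ := by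
    rw [← mul_inv, mul_self_sqrt (by positivity)]
  rw [gaussDensity2, gaussDensity1, gaussDensity1, mul_pow, sq_sqrt hρ.le, hexp, exp_add,
    sqrt_mul (by positivity) (σ₁ ^ 2), sqrt_mul (by positivity) (σ₂ ^ 2 * _),
    sqrt_mul (by positivity) (1 - ρ ^ 2), sqrt_sq hσ₁.le, sqrt_sq hσ₂.le,
    mul_inv, mul_inv, mul_inv, hπ, mul_inv, mul_inv, mul_inv]
  ring

lemma E2_swap (σ₁ σ₂ ρ a b : ℝ) : E2 σ₁ σ₂ ρ a b = E2 σ₂ σ₁ ρ b a := by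
  rw [E2, E2, Measure.volume_eq_prod, ← integral_prod_swap]
  refine integral_congr_ae (.of_forall fun q => ?_)
  simp only [gaussDensity2, Prod.fst_swap, Prod.snd_swap]
  ring_nf

/-- Mixed absolute moments with an even second exponent, as a finite sum. -/
lemma E2_two_mul {σ₁ σ₂ ρ : ℝ} (hσ₁ : 0 < σ₁) (hσ₂ : 0 < σ₂) (hρ : 0 < 1 - ρ ^ 2) (m N : ℕ) :
    E2 σ₁ σ₂ ρ m (2 * N : ℕ) = ∑ j ∈ Finset.range (N + 1),
      ((2 * N).choose (2 * j) : ℝ) * (ρ * σ₂ / σ₁) ^ (2 * j) *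
        E1 (σ₂ * √(1 - ρ ^ 2)) (2 * (N - j) : ℕ) * E1 σ₁ (m + 2 * j : ℕ) := by
  have hs : 0 < σ₂ * √(1 - ρ ^ 2) := by positivity
  set s := σ₂ * √(1 - ρ ^ 2)
  set c := ρ * σ₂ / σ₁
  let F : ℝ × ℝ → ℝ := fun q =>
    (|q.1| ^ m * gaussDensity1 σ₁ q.1) * (q.2 ^ (2 * N) * gaussDensity1 s (q.2 - c * q.1))
  have hE2 : E2 σ₁ σ₂ ρ m (2 * N : ℕ) = ∫ q, F q := by
    refine integral_congr_ae (.of_forall fun q => ?_)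
    simp only [F, rpow_natCast, (even_two_mul N).pow_abs, gaussDensity2_eq hσ₁ hσ₂ hρ]
    ring
  have hF_nonneg : ∀ q, 0 ≤ F q := fun q =>
    mul_nonneg (mul_nonneg (by positivity) (gaussDensity1_nonneg _ _))
      (mul_nonneg ((even_two_mul N).pow_nonneg _) (gaussDensity1_nonneg _ _))
  have hF_meas : Measurable F := by
    have h₁ := measurable_gaussDensity1 σ₁
    have h₂ := measurable_gaussDensity1 s
    fun_prop
  have hinner : ∀ x, ∫ y, F (x, y) = ∑ j ∈ Finset.range (N + 1),
      ((2 * N).choose (2 * j) : ℝ) * c ^ (2 * j) * E1 s (2 * (N - j) : ℕ) *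
        (|x| ^ (m + 2 * j) * gaussDensity1 σ₁ x) := by
    intro x
    simp only [F]
    rw [integral_const_mul, integral_pow_two_mul_mul_gaussDensity1_sub hs, Finset.mul_sum]
    refine Finset.sum_congr rfl fun j _ => ?_
    rw [mul_pow c x, pow_add |x|, (even_two_mul j).pow_abs]
    ring
  have hterm : ∀ j ∈ Finset.range (N + 1), Integrable fun x =>
      ((2 * N).choose (2 * j) : ℝ) * c ^ (2 * j) * E1 s (2 * (N - j) : ℕ) *
        (|x| ^ (m + 2 * j) * gaussDensity1 σ₁ x) := fun j _ =>
    (integrable_abs_pow_mul_gaussDensity1 hσ₁ _).const_mul _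
  have hF : Integrable F (volume.prod volume) := by
    rw [integrable_prod_iff hF_meas.aestronglyMeasurable]
    refine ⟨.of_forall fun x =>
      (integrable_pow_mul_gaussDensity1_sub hs (c * x) (2 * N)).const_mul
        (|x| ^ m * gaussDensity1 σ₁ x), ?_⟩
    simp_rw [norm_of_nonneg (hF_nonneg _), hinner]
    exact integrable_finsetSum _ hterm
  rw [hE2, Measure.volume_eq_prod, integral_prod _ hF]
  simp_rw [hinner]
  rw [integral_finsetSum _ hterm]
  simp_rw [integral_const_mul, ← E1_natCast]

lemma E1_nonneg (σ a : ℝ) : 0 ≤ E1 σ a :=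
  integral_nonneg fun x => by positivity

/-- Quantitative Gaussian product inequality when the second exponent is even. -/
lemma E1_mul_E1_mul_le_E2 {σ₁ σ₂ ρ : ℝ} (hσ₁ : 0 < σ₁) (hσ₂ : 0 < σ₂) (hρ : 0 < 1 - ρ ^ 2)
    {m : ℕ} (hm : 2 ≤ m) (N : ℕ) :
    E1 σ₁ m * E1 σ₂ (2 * N : ℕ) * (1 + m * N * ρ ^ 2) ≤ E2 σ₁ σ₂ ρ m (2 * N : ℕ) := by
  have hs : 0 < σ₂ * √(1 - ρ ^ 2) := by positivity
  rw [E2_two_mul hσ₁ hσ₂ hρ, ← sum_choose_mul_one_add, Finset.mul_sum]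
  refine Finset.sum_le_sum fun j hj => ?_
  have hjN : j ≤ N := Nat.lt_succ_iff.1 (Finset.mem_range.1 hj)
  have hch : ((2 * N).choose (2 * j) : ℝ) * (2 * (N - j) - 1).doubleFactorial *
      (2 * j - 1).doubleFactorial = N.choose j * (2 * N - 1).doubleFactorial := by
    exact_mod_cast choose_two_mul_mul_doubleFactorial hjN
  rw [E1_two_mul hs, E1_two_mul hσ₂, E1_add_two_mul hσ₁, mul_pow σ₂, pow_mul √(1 - ρ ^ 2),
    sq_sqrt hρ.le, div_pow, mul_pow ρ]
  have hσ : σ₂ ^ (2 * N) = σ₂ ^ (2 * j) * σ₂ ^ (2 * (N - j)) := by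
    rw [← pow_add, ← mul_add, Nat.add_sub_cancel' hjN]
  have hW : 0 ≤ ((2 * N).choose (2 * j) : ℝ) * (2 * (N - j) - 1).doubleFactorial *
      (ρ ^ 2) ^ j * (1 - ρ ^ 2) ^ (N - j) * σ₂ ^ (2 * N) * E1 σ₁ m := by
    have := E1_nonneg σ₁ m
    positivity
  refine le_of_eq_of_le ?_ ((mul_le_mul_of_nonneg_left (doubleFactorial_mul_le_prod m j hm)
    hW).trans_eq ?_)
  · linear_combination (-(E1 σ₁ m * σ₂ ^ (2 * N) * (ρ ^ 2) ^ j * (1 - ρ ^ 2) ^ (N - j) *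
      (1 + m * j))) * hch
  · rw [hσ, ← pow_mul]
    field_simp

/-- Product of an odd and an even absolute moment in terms of double factorials. -/
lemma E1_mul_E1_of_odd_of_even {σ₁ σ₂ : ℝ} (hσ₁ : 0 < σ₁) (hσ₂ : 0 < σ₂) {m N : ℕ} (hm : Odd m) :
    E1 σ₁ m * E1 σ₂ (2 * N : ℕ) = 2 * ((m - 1).doubleFactorial * (2 * N - 1).doubleFactorial *
      σ₁ ^ m * σ₂ ^ (2 * N)) / √(2 * π) := by
  obtain ⟨k, rfl⟩ := hm
  rw [E1_two_mul_add_one hσ₁, E1_two_mul hσ₂, Nat.add_sub_cancel]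
  ring

/-- Quantitative Gaussian product inequality for an odd first and an even second exponent. -/
lemma gpi_quantitative_of_odd_of_even {σ₁ σ₂ ρ : ℝ} (hσ₁ : 0 < σ₁) (hσ₂ : 0 < σ₂)
    (hρ : 0 < 1 - ρ ^ 2) {m n : ℕ} (hm : 2 ≤ m) (hmo : Odd m) (hne : Even n) :
    (Nat.doubleFactorial (m - 1) : ℝ) * (Nat.doubleFactorial (n - 1) : ℝ) *
        m * n * σ₁ ^ (m : ℝ) * σ₂ ^ (n : ℝ) * ρ ^ 2 / √(2 * π) ≤
      E2 σ₁ σ₂ ρ m n - E1 σ₁ m * E1 σ₂ n := by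
  obtain ⟨N, rfl⟩ := hne.exists_two_nsmul
  rw [smul_eq_mul]
  have h := E1_mul_E1_mul_le_E2 hσ₁ hσ₂ hρ hm N
  rw [mul_add, mul_one] at h
  refine le_trans (le_of_eq ?_) (le_sub_iff_add_le'.2 h)
  rw [E1_mul_E1_of_odd_of_even hσ₁ hσ₂ hmo, rpow_natCast, rpow_natCast]
  push_cast
  ring

theorem gpi_quantitative_odd_even (σ₁ σ₂ ρ : ℝ) (m n : ℕ)
    (hσ₁ : 0 < σ₁) (hσ₂ : 0 < σ₂) (hρ : ρ ∈ Set.Ioo (-1 : ℝ) 1)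
    (hm : 2 < m) (hn : 2 < n)
    (hpar : (Odd m ∧ Even n) ∨ (Even m ∧ Odd n)) :
    E2 σ₁ σ₂ ρ (m : ℝ) (n : ℝ) - E1 σ₁ (m : ℝ) * E1 σ₂ (n : ℝ) ≥
      (Nat.doubleFactorial (m - 1) : ℝ) * (Nat.doubleFactorial (n - 1) : ℝ) *
        m * n * σ₁ ^ (m : ℝ) * σ₂ ^ (n : ℝ) * ρ ^ 2 / Real.sqrt (2 * π) := by
  have hρ' : 0 < 1 - ρ ^ 2 := by nlinarith [hρ.1, hρ.2]
  rcases hpar with ⟨hmo, hne⟩ | ⟨hme, hno⟩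
  · exact gpi_quantitative_of_odd_of_even hσ₁ hσ₂ hρ' hm.le hmo hne
  · rw [E2_swap, mul_comm (E1 σ₁ _)]
    refine (le_of_eq ?_).trans (gpi_quantitative_of_odd_of_even hσ₂ hσ₁ hρ' hn.le hno hme)
    ring
end

section
/- Let σ1, σ2 > 0 and suppose either (i) α1, α2 > 0, or (ii) α1, α2 ∈ (−1,0) and α1 + α2 ∈ (−1,0). Consider the perfectly correlated case ρ = ±1, i.e. X2 = ±(σ2/σ1)X1 with X1 centered Gaussian of variance σ1², so that E[|X1|^{α1}|X2|^{α2}] = (σ2/σ1)^{α2} ∫_ℝ |x|^{α1+α2} (2πσ1²)^{−1/2} e^{−x²/(2σ1²)} dx. Then E[|X1|^{α1}|X2|^{α2}] − E[|X1|^{α1}]·E[|X2|^{α2}] ≥ f(σ1,σ2,α1,α2,±1), where f(σ1,σ2,α1,α2,ρ) = (2^{(α1+α2)/2} α1 α2 σ1^{α1} σ2^{α2} ρ² / (2π)) Γ((α1+1)/2)Γ((α2+1)/2) if −1<α1,α2<0 or 0<α1,α2≤2 or α1,α2>2, and f(σ1,σ2,α1,α2,ρ) = (2^{(α1+α2)/2}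 α1 α2 σ1^{α1} σ2^{α2} ρ² / (4√π)) Γ((α1+α2−1)/2) if α1>2 and 0<α2<2, or 0<α1<2 and α2>2. -/
open MeasureTheory Real

/-- `Γ(s + a) Γ(s + b) ≤ Γ(s) Γ(s + a + b)` for shifts `a`, `b` of the same sign: log-convexity
of the Gamma function. -/
lemma Gamma_add_mul_Gamma_add_le {s a b : ℝ} (hs : 0 < s) (hsab : 0 < s + a + b)
    (hab : 0 < a * b) :
    Gamma (s + a) * Gamma (s + b) ≤ Gamma s * Gamma (s + a + b) := by
  have hne : a + b ≠ 0 := by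
    intro h
    have : b = -a := by linarith
    subst this
    nlinarith [sq_nonneg a]
  have hpos : ∀ {x y : ℝ}, 0 < x * y → x + y ≠ 0 → 0 < x / (x + y) := by
    intro x y h hxy
    rcases pos_and_pos_or_neg_and_neg_of_mul_pos h with ⟨hx, hy⟩ | ⟨hx, hy⟩
    · positivity
    · exact div_pos_of_neg_of_neg hx (by linarith)
  have hp : 0 < a / (a + b) := hpos hab hne
  have hq : 0 < b / (a + b) := by
    rw [add_comm]
    exact hpos (by linarith [mul_comm a b]) (by rwa [add_comm])
  have hpq : a / (a + b) + b / (a + b) = 1 := by field_simp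
  have ha := Real.Gamma_mul_add_mul_le_rpow_Gamma_mul_rpow_Gamma hs hsab hq hp
    (by linarith)
  have hb := Real.Gamma_mul_add_mul_le_rpow_Gamma_mul_rpow_Gamma hs hsab hp hq hpq
  have hpa : b / (a + b) * s + a / (a + b) * (s + a + b) = s + a := by field_simp; ring
  have hpb : a / (a + b) * s + b / (a + b) * (s + a + b) = s + b := by field_simp; ring
  rw [hpa] at ha
  rw [hpb] at hb
  have hΓ := Gamma_pos_of_pos hs
  have hΓ' := Gamma_pos_of_pos hsab
  calc Gamma (s + a) * Gamma (s + b)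
      ≤ (Gamma s ^ (b / (a + b)) * Gamma (s + a + b) ^ (a / (a + b))) *
          (Gamma s ^ (a / (a + b)) * Gamma (s + a + b) ^ (b / (a + b))) := by
        have hΓb : 0 ≤ Gamma (s + b) := by
          rw [← hpb]
          exact (Gamma_pos_of_pos (by positivity)).le
        exact mul_le_mul ha hb hΓb (by positivity)
    _ = Gamma s ^ (a / (a + b) + b / (a + b)) *
          Gamma (s + a + b) ^ (a / (a + b) + b / (a + b)) := by
        rw [rpow_add hΓ, rpow_add hΓ']
        ring
    _ = Gamma s * Gamma (s + a + b) := by rw [hpq, rpow_one, rpow_one]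

lemma tendsto_const_div_add_natCast (c d : ℝ) :
    Filter.Tendsto (fun n : ℕ => c / (d + n)) Filter.atTop (nhds 0) :=
  (Filter.tendsto_atTop_add_const_left _ d tendsto_natCast_atTop_atTop).const_div_atTop c

lemma one_add_div_mul_Gamma_le_aux {a b : ℝ} (hab : 0 < a * b) (h1 : 0 ≤ (1 - a) * (1 - b))
    (n : ℕ) : ∀ s : ℝ, 0 < s → 0 < s + a → 0 < s + b → 0 < s + a + b →
    (1 + a * b / s) * (Gamma (s + a) * Gamma (s + b)) ≤
      (1 + a * b / (s + n)) * (Gamma s * Gamma (s + a + b)) := by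
  induction n with
  | zero =>
    intro s hs _ _ hsab
    simp only [Nat.cast_zero, add_zero]
    exact mul_le_mul_of_nonneg_left (Gamma_add_mul_Gamma_add_le hs hsab hab) (by positivity)
  | succ n ih =>
    intro s hs hsa hsb hsab
    have h := ih (s + 1) (by linarith) (by linarith) (by linarith) (by linarith)
    rw [show s + 1 + a + b = s + a + b + 1 by ring, show s + 1 + a = s + a + 1 by ring,
      show s + 1 + b = s + b + 1 by ring, Gamma_add_one hs.ne', Gamma_add_one hsa.ne',
      Gamma_add_one hsb.ne', Gamma_add_one hsab.ne',
      show s + 1 + (n : ℝ) = s + ((n + 1 : ℕ) : ℝ) by push_cast; ring] at h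
    have hstep : (1 + a * b / s) * (s * (s + a + b)) ≤
        (1 + a * b / (s + 1)) * ((s + a) * (s + b)) := by
      have : (1 + a * b / (s + 1)) * ((s + a) * (s + b)) - (1 + a * b / s) * (s * (s + a + b)) =
          a * b * ((1 - a) * (1 - b)) / (s + 1) := by
        field_simp
        ring
      have : 0 ≤ a * b * ((1 - a) * (1 - b)) / (s + 1) := by positivity
      linarith
    have hΓ := mul_pos (Gamma_pos_of_pos hsa) (Gamma_pos_of_pos hsb)
    refine le_of_mul_le_mul_left ?_ (mul_pos hs hsab)
    linarith [mul_le_mul_of_nonneg_right hstep hΓ.le]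

lemma one_add_div_mul_Gamma_le {s a b : ℝ} (hab : 0 < a * b) (h1 : 0 ≤ (1 - a) * (1 - b))
    (hs : 0 < s) (hsa : 0 < s + a) (hsb : 0 < s + b) (hsab : 0 < s + a + b) :
    (1 + a * b / s) * (Gamma (s + a) * Gamma (s + b)) ≤ Gamma s * Gamma (s + a + b) := by
  have hlim := ((tendsto_const_div_add_natCast (a * b) s).const_add 1).mul_const
    (Gamma s * Gamma (s + a + b))
  rw [add_zero, one_mul] at hlim
  exact ge_of_tendsto' hlim fun n =>
    one_add_div_mul_Gamma_le_aux hab h1 n s hs hsa hsb hsab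

lemma Gamma_mul_le_one_sub_div_aux {a b : ℝ} (ha : 0 < a) (hb : 0 < b)
    (h1 : (1 - a) * (1 - b) ≤ 0) (n : ℕ) : ∀ s : ℝ, 0 < s → 0 < a + b + s - 1 →
    (1 - a * b / (a + b + s - 1 + n)) * (Gamma (s + a) * Gamma (s + b)) ≤
      (1 - a * b / (a + b + s - 1)) * (Gamma s * Gamma (s + a + b)) := by
  induction n with
  | zero =>
    intro s hs hc
    simp only [Nat.cast_zero, add_zero]
    have hnonneg : 0 ≤ 1 - a * b / (a + b + s - 1) := by
      rw [sub_nonneg, div_le_one hc]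
      linarith
    exact mul_le_mul_of_nonneg_left
      (Gamma_add_mul_Gamma_add_le hs (by linarith) (mul_pos ha hb)) hnonneg
  | succ n ih =>
    intro s hs hc
    have hsa : 0 < s + a := by linarith
    have hsb : 0 < s + b := by linarith
    have hsab : 0 < s + a + b := by linarith
    have h := ih (s + 1) (by linarith) (by linarith)
    rw [show s + 1 + a + b = s + a + b + 1 by ring, show s + 1 + a = s + a + 1 by ring,
      show s + 1 + b = s + b + 1 by ring, Gamma_add_one hs.ne', Gamma_add_one hsa.ne',
      Gamma_add_one hsb.ne', Gamma_add_one hsab.ne',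
      show a + b + (s + 1) - 1 + (n : ℝ) = a + b + s - 1 + ((n + 1 : ℕ) : ℝ) by push_cast; ring,
      show a + b + (s + 1) - 1 = s + a + b by ring] at h
    have hstep : (1 - a * b / (s + a + b)) * (s * (s + a + b)) ≤
        (1 - a * b / (a + b + s - 1)) * ((s + a) * (s + b)) := by
      have : (1 - a * b / (a + b + s - 1)) * ((s + a) * (s + b)) -
          (1 - a * b / (s + a + b)) * (s * (s + a + b)) =
          a * b * -((1 - a) * (1 - b)) / (a + b + s - 1) := by
        field_simp
        ring
      have : 0 ≤ a * b * -((1 - a) * (1 - b)) / (a + b + s - 1) :=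
        div_nonneg (mul_nonneg (mul_pos ha hb).le (by linarith)) hc.le
      linarith
    have hΓ := mul_pos (Gamma_pos_of_pos hs) (Gamma_pos_of_pos hsab)
    refine le_of_mul_le_mul_left ?_ (mul_pos hsa hsb)
    linarith [mul_le_mul_of_nonneg_right hstep hΓ.le]

lemma Gamma_mul_le_one_sub_div {s a b : ℝ} (ha : 0 < a) (hb : 0 < b)
    (h1 : (1 - a) * (1 - b) ≤ 0) (hs : 0 < s) (hc : 0 < a + b + s - 1) :
    Gamma (s + a) * Gamma (s + b) ≤
      (1 - a * b / (a + b + s - 1)) * (Gamma s * Gamma (s + a + b)) := by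
  have hlim := ((tendsto_const_div_add_natCast (a * b) (a + b + s - 1)).const_sub 1).mul_const
    (Gamma (s + a) * Gamma (s + b))
  rw [sub_zero, one_mul] at hlim
  exact le_of_tendsto' hlim fun n => Gamma_mul_le_one_sub_div_aux ha hb h1 n s hs hc

lemma E1_eq {σ a : ℝ} (hσ : 0 < σ) (ha : -1 < a) :
    E1 σ a = 2 ^ (a / 2) * σ ^ a / √π * Gamma ((a + 1) / 2) := by
  have hσ2 : 0 < 2 * σ ^ 2 := by positivity
  have hint : E1 σ a = (√(2 * π * σ ^ 2))⁻¹ *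
      (2 * ∫ x in Set.Ioi (0 : ℝ), x ^ a * exp (-(2 * σ ^ 2)⁻¹ * x ^ (2 : ℝ))) := by
    rw [← integral_comp_abs (f := fun x => x ^ a * exp (-(2 * σ ^ 2)⁻¹ * x ^ (2 : ℝ))),
      ← integral_const_mul, E1]
    congr 1 with x
    rw [rpow_two, sq_abs, show -x ^ 2 / (2 * σ ^ 2) = -(2 * σ ^ 2)⁻¹ * x ^ 2 by ring]
    ring
  have hsqrt : √(2 * π * σ ^ 2) = √π * (2 * σ ^ 2) ^ (1 / 2 : ℝ) := by
    rw [← sqrt_eq_rpow, ← sqrt_mul pi_pos.le]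
    congr 1
    ring
  have hpow : ((2 * σ ^ 2)⁻¹) ^ (-(a + 1) / 2) =
      2 ^ (a / 2) * σ ^ a * (2 * σ ^ 2) ^ (1 / 2 : ℝ) := by
    rw [inv_rpow hσ2.le, ← rpow_neg hσ2.le, show -(-(a + 1) / 2) = a / 2 + 1 / 2 by ring,
      rpow_add hσ2, mul_rpow (by norm_num) (by positivity) (z := a / 2), ← rpow_natCast σ 2,
      ← rpow_mul hσ.le]
    congr 3
    push_cast
    ring
  rw [hint, integral_rpow_mul_exp_neg_mul_rpow (by norm_num) ha (inv_pos.mpr hσ2), hpow, hsqrt]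
  have := sqrt_pos.mpr pi_pos
  have : 0 < (2 * σ ^ 2) ^ (1 / 2 : ℝ) := by positivity
  field_simp

/-- The covariance of the absolute powers, in terms of Gamma values. -/
lemma covariance_abs_rpow_eq {σ₁ σ₂ α₁ α₂ : ℝ} (hσ₁ : 0 < σ₁) (hσ₂ : 0 < σ₂) (h₁ : -1 < α₁)
    (h₂ : -1 < α₂) (h₁₂ : -1 < α₁ + α₂) :
    (σ₂ / σ₁) ^ α₂ * E1 σ₁ (α₁ + α₂) - E1 σ₁ α₁ * E1 σ₂ α₂ =
      2 ^ ((α₁ + α₂) / 2) * σ₁ ^ α₁ * σ₂ ^ α₂ / π *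
        (√π * Gamma ((α₁ + α₂ + 1) / 2) - Gamma ((α₁ + 1) / 2) * Gamma ((α₂ + 1) / 2)) := by
  rw [E1_eq hσ₁ h₁, E1_eq hσ₂ h₂, E1_eq hσ₁ h₁₂, div_rpow hσ₂.le hσ₁.le, rpow_add hσ₁,
    add_div α₁ α₂, rpow_add two_pos]
  have hπ : √π * √π = π := mul_self_sqrt pi_pos.le
  have := sqrt_pos.mpr pi_pos
  have : 0 < σ₁ ^ α₂ := by positivity
  rw [← hπ, sqrt_mul_self (by positivity)]
  field_simp

theorem gpi_quantitative_perfect_correlation (σ₁ σ₂ ρ α₁ α₂ : ℝ)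
    (hσ₁ : 0 < σ₁) (hσ₂ : 0 < σ₂) (hρ : ρ = 1 ∨ ρ = -1)
    (hα : (0 < α₁ ∧ 0 < α₂) ∨
      (α₁ ∈ Set.Ioo (-1 : ℝ) 0 ∧ α₂ ∈ Set.Ioo (-1 : ℝ) 0 ∧
        α₁ + α₂ ∈ Set.Ioo (-1 : ℝ) 0)) :
    (((-1 < α₁ ∧ α₁ < 0 ∧ -1 < α₂ ∧ α₂ < 0) ∨
        (0 < α₁ ∧ α₁ ≤ 2 ∧ 0 < α₂ ∧ α₂ ≤ 2) ∨ (2 < α₁ ∧ 2 < α₂)) →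
      (σ₂ / σ₁) ^ α₂ * E1 σ₁ (α₁ + α₂) - E1 σ₁ α₁ * E1 σ₂ α₂ ≥
        2 ^ ((α₁ + α₂) / 2) * α₁ * α₂ * σ₁ ^ α₁ * σ₂ ^ α₂ * ρ ^ 2 / (2 * π) *
          Real.Gamma ((α₁ + 1) / 2) * Real.Gamma ((α₂ + 1) / 2)) ∧
    (((2 < α₁ ∧ 0 < α₂ ∧ α₂ < 2) ∨ (0 < α₁ ∧ α₁ < 2 ∧ 2 < α₂)) →
      (σ₂ / σ₁) ^ α₂ * E1 σ₁ (α₁ + α₂) - E1 σ₁ α₁ * E1 σ₂ α₂ ≥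
        2 ^ ((α₁ + α₂) / 2) * α₁ * α₂ * σ₁ ^ α₁ * σ₂ ^ α₂ * ρ ^ 2 /
          (4 * Real.sqrt π) * Real.Gamma ((α₁ + α₂ - 1) / 2)) := by
  have hρ2 : ρ ^ 2 = 1 := by rcases hρ with rfl | rfl <;> norm_num
  have h₁ : -1 < α₁ := by rcases hα with h | h <;> [linarith [h.1]; exact h.1.1]
  have h₂ : -1 < α₂ := by rcases hα with h | h <;> [linarith [h.2]; exact h.2.1.1]
  have h₁₂ : -1 < α₁ + α₂ := by rcases hα with h | h <;> [linarith [h.1, h.2]; exact h.2.2.1]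
  have hab : 0 < α₁ / 2 * (α₂ / 2) := by
    rcases hα with h | h
    · exact mul_pos (by linarith [h.1]) (by linarith [h.2])
    · exact mul_pos_of_neg_of_neg (by linarith [h.1.2]) (by linarith [h.2.1.2])
  have e₁ : (α₁ + 1) / 2 = 1 / 2 + α₁ / 2 := by ring
  have e₂ : (α₂ + 1) / 2 = 1 / 2 + α₂ / 2 := by ring
  have e₁₂ : (α₁ + α₂ + 1) / 2 = 1 / 2 + α₁ / 2 + α₂ / 2 := by ring
  have hC : 0 ≤ 2 ^ ((α₁ + α₂) / 2) * σ₁ ^ α₁ * σ₂ ^ α₂ / π := by positivity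
  rw [covariance_abs_rpow_eq hσ₁ hσ₂ h₁ h₂ h₁₂, hρ2]
  refine ⟨fun h => ?_, fun h => ?_⟩
  · have hsign : 0 ≤ (1 - α₁ / 2) * (1 - α₂ / 2) := by
      rcases h with h | h | h
      · exact mul_nonneg (by linarith) (by linarith)
      · exact mul_nonneg (by linarith) (by linarith)
      · exact mul_nonneg_of_nonpos_of_nonpos (by linarith) (by linarith)
    have key := one_add_div_mul_Gamma_le (s := 1 / 2) hab hsign (by norm_num) (by linarith)
      (by linarith) (by linarith)
    rw [Gamma_one_half_eq, ← e₁₂, ← e₁, ← e₂] at key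
    calc _ = 2 ^ ((α₁ + α₂) / 2) * σ₁ ^ α₁ * σ₂ ^ α₂ / π *
          (α₁ * α₂ / 2 * (Gamma ((α₁ + 1) / 2) * Gamma ((α₂ + 1) / 2))) := by
          field_simp
      _ ≤ _ := mul_le_mul_of_nonneg_left (by linarith) hC
  · have hsign : (1 - α₁ / 2) * (1 - α₂ / 2) ≤ 0 := by
      rcases h with h | h
      · exact mul_nonpos_of_nonpos_of_nonneg (by linarith) (by linarith)
      · exact mul_nonpos_of_nonneg_of_nonpos (by linarith) (by linarith)
    have hpos : 0 < α₁ / 2 ∧ 0 < α₂ / 2 ∧ 0 < (α₁ + α₂ - 1) / 2 := by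
      rcases h with h | h <;> refine ⟨?_, ?_, ?_⟩ <;> linarith
    have key := Gamma_mul_le_one_sub_div (s := 1 / 2) hpos.1 hpos.2.1 hsign (by norm_num)
      (by linarith [hpos.2.2])
    have hΓ : Gamma ((α₁ + α₂ + 1) / 2) =
        (α₁ + α₂ - 1) / 2 * Gamma ((α₁ + α₂ - 1) / 2) := by
      rw [← Gamma_add_one hpos.2.2.ne']
      congr 1
      ring
    rw [Gamma_one_half_eq, ← e₁₂, ← e₁, ← e₂,
      show α₁ / 2 + α₂ / 2 + 1 / 2 - 1 = (α₁ + α₂ - 1) / 2 by ring, sub_mul, one_mul] at key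
    have hterm : α₁ / 2 * (α₂ / 2) / ((α₁ + α₂ - 1) / 2) *
        (√π * Gamma ((α₁ + α₂ + 1) / 2)) =
        α₁ * α₂ / 4 * (√π * Gamma ((α₁ + α₂ - 1) / 2)) := by
      rw [hΓ]
      have := hpos.2.2.ne'
      generalize (α₁ + α₂ - 1) / 2 = c at *
      field_simp
      ring
    rw [hterm] at key
    calc _ = 2 ^ ((α₁ + α₂) / 2) * σ₁ ^ α₁ * σ₂ ^ α₂ / π *
          (α₁ * α₂ / 4 * (√π * Gamma ((α₁ + α₂ - 1) / 2))) := by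
          have hπ : √π * √π = π := mul_self_sqrt pi_pos.le
          have := sqrt_pos.mpr pi_pos
          rw [← hπ, sqrt_mul_self this.le]
          field_simp
      _ ≤ _ := mul_le_mul_of_nonneg_left (by linarith) hC
end

section
/- (Nabeya's formula.) Let σ1, σ2 > 0, ρ ∈ (−1,1), and α1, α2 > −1. Then E[|X1|^{α1}|X2|^{α2}] = (2^{(α1+α2)/2} σ1^{α1} σ2^{α2} / π) · Γ((α1+1)/2) · Γ((α2+1)/2) · F(−α1/2, −α2/2; 1/2; ρ²), where F is the Gauss hypergeometric series. -/
open MeasureTheory Real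

/-- Gauss hypergeometric series F(a,b;c;z). -/
noncomputable def hypF (a b c z : ℝ) : ℝ :=
  ∑' n : ℕ, (ascPochhammer ℝ n).eval a * (ascPochhammer ℝ n).eval b /
    ((ascPochhammer ℝ n).eval c * (n.factorial : ℝ)) * z ^ n

/-- The binomial series `(1 - z) ^ (-s) = ∑ (s)ₙ / n! zⁿ`, with absolute convergence. -/
lemma hasSum_ascPochhammer_div_factorial_mul_pow (s : ℝ) {z : ℝ} (hz : |z| < 1) :
    (Summable fun n : ℕ ↦ ‖(ascPochhammer ℝ n).eval s / (n.factorial : ℝ) * z ^ n‖) ∧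
      HasSum (fun n : ℕ ↦ (ascPochhammer ℝ n).eval s / (n.factorial : ℝ) * z ^ n)
        ((1 - z) ^ (-s)) := by
  have hcoeff (n : ℕ) :
      Ring.choose (s + n - 1) n = (ascPochhammer ℝ n).eval s / (n.factorial : ℝ) := by
    have h := Ring.factorial_nsmul_multichoose_eq_ascPochhammer s n
    rw [Polynomial.ascPochhammer_smeval_eq_eval, nsmul_eq_mul] at h
    rw [Ring.choose, show s + n - 1 - n + 1 = s by ring, ← h,
      mul_div_cancel_left₀ _ (by exact_mod_cast n.factorial_ne_zero)]
  have H := Real.one_div_one_sub_rpow_hasFPowerSeriesOnBall_zero s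
  simp only [hcoeff] at H
  have hz1 : z ∈ Metric.eball (0 : ℝ) 1 := by
    rw [Metric.mem_eball, edist_zero_right, ← ofReal_norm, Real.norm_eq_abs]
    exact ENNReal.ofReal_lt_one.2 hz
  constructor
  · have h := FormalMultilinearSeries.summable_norm_apply _ (Metric.eball_subset_eball H.r_le hz1)
    simpa [FormalMultilinearSeries.ofScalars_apply_eq, mul_comm] using h
  · have h := H.hasSum hz1
    have h1 : 0 ≤ 1 - z := by linarith [(abs_lt.1 hz).2]
    simpa [FormalMultilinearSeries.ofScalars_apply_eq, rpow_neg h1, mul_comm] using h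

/-- Absolute convergence of the Gauss series with positive parameters inside the unit disc. -/
lemma summable_norm_hypergeometric {a b c z : ℝ} (ha : 0 < a) (hb : 0 < b) (hc : 0 < c)
    (hz : |z| < 1) :
    Summable fun n : ℕ ↦ ‖(ascPochhammer ℝ n).eval a * (ascPochhammer ℝ n).eval b /
      ((ascPochhammer ℝ n).eval c * (n.factorial : ℝ)) * z ^ n‖ := by
  have hr := ordinaryHypergeometricSeries_radius_eq_one (𝔸 := ℝ) a b c fun k ↦ by
    have : (0 : ℝ) ≤ k := k.cast_nonneg
    exact ⟨by linarith, by linarith, by linarith⟩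
  have hz1 : z ∈ Metric.eball (0 : ℝ) (ordinaryHypergeometricSeries ℝ a b c).radius := by
    rw [hr, Metric.mem_eball, edist_zero_right, ← ofReal_norm, Real.norm_eq_abs]
    exact ENNReal.ofReal_lt_one.2 hz
  refine (FormalMultilinearSeries.summable_norm_apply _ hz1).congr fun n ↦ ?_
  rw [ordinaryHypergeometricSeries_apply_eq, smul_eq_mul]
  congr 1
  rw [div_eq_mul_inv, mul_inv]
  ring

/-- The **Pfaff–Saalschütz identity**, in the form of the Cauchy product behind Euler's
transformation of the Gauss series. -/
lemma sum_range_hypergeometric_mul_ascPochhammer {c : ℝ} (hc : 0 < c) (u v : ℝ) (n : ℕ) :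
    ∑ k ∈ Finset.range (n + 1), (ascPochhammer ℝ k).eval u * (ascPochhammer ℝ k).eval v /
        ((ascPochhammer ℝ k).eval c * (k.factorial : ℝ)) *
        ((ascPochhammer ℝ (n - k)).eval (c - u - v) / ((n - k).factorial : ℝ)) =
      (ascPochhammer ℝ n).eval (c - u) * (ascPochhammer ℝ n).eval (c - v) /
        ((ascPochhammer ℝ n).eval c * (n.factorial : ℝ)) := by
  set t : ℕ → ℝ := fun k ↦ (ascPochhammer ℝ k).eval u * (ascPochhammer ℝ k).eval v /
        ((ascPochhammer ℝ k).eval c * (k.factorial : ℝ)) with ht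
  set w : ℕ → ℝ := fun j ↦ (ascPochhammer ℝ j).eval (c - u - v) / (j.factorial : ℝ) with hw
  have hcn (m : ℕ) : (ascPochhammer ℝ m).eval c ≠ 0 := (ascPochhammer_pos m c hc).ne'
  have hcm (m : ℕ) : c + m ≠ 0 := by positivity
  have hfac (m : ℕ) : (m.factorial : ℝ) ≠ 0 := by positivity
  have hm (m : ℕ) : (m : ℝ) + 1 ≠ 0 := by positivity
  have ht1 (k : ℕ) : (k + 1) * (c + k) * t (k + 1) = (u + k) * (v + k) * t k := by
    have := hcn k; have := hcm k; have := hfac k; have := hm k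
    simp only [ht, ascPochhammer_succ_eval, Nat.factorial_succ, Nat.cast_mul, Nat.cast_succ]
    field_simp
  have hw1 (j : ℕ) : (j + 1) * w (j + 1) = (c - u - v + j) * w j := by
    have := hfac j; have := hm j
    simp only [hw, ascPochhammer_succ_eval, Nat.factorial_succ, Nat.cast_mul, Nat.cast_succ]
    field_simp
  change ∑ k ∈ Finset.range (n + 1), t k * w (n - k) = _
  induction n with
  | zero => simp [ht, hw]
  | succ n ih =>
    -- Zeilberger's recurrence in `n`, with the telescoping certificate `G`
    set G : ℕ → ℝ := fun k ↦ -(k * (c + k - 1) * t k * w (n + 1 - k)) with hG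
    have tele : ∑ k ∈ Finset.range (n + 1),
        ((c + n) * (n + 1) * (t k * w (n + 1 - k)) -
          (c - u + n) * (c - v + n) * (t k * w (n - k))) = G (n + 1) - G 0 := by
      rw [← Finset.sum_range_sub]
      refine Finset.sum_congr rfl fun k hk ↦ ?_
      obtain ⟨j, rfl⟩ := Nat.exists_eq_add_of_le (Nat.lt_succ_iff.1 (Finset.mem_range.1 hk))
      have e1 : k + j + 1 - k = j + 1 := by omega
      have e2 : k + j - k = j := by omega
      have e3 : k + j + 1 - (k + 1) = j := by omega
      simp only [hG, e1, e2, e3]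
      have h1 := ht1 k
      have h2 := hw1 j
      have : w (j + 1) = (c - u - v + j) * w j / (j + 1) := by
        rw [← h2, mul_div_cancel_left₀ _ (hm j)]
      have h3 : ((k + 1 : ℕ) : ℝ) * (c + (k + 1 : ℕ) - 1) * t (k + 1) * w j =
          (u + k) * (v + k) * t k * w j := by
        rw [← h1]; push_cast; ring
      rw [h3, this]
      have := hm j
      push_cast
      field_simp
      ring
    rw [Finset.sum_sub_distrib, ← Finset.mul_sum, ← Finset.mul_sum, ih] at tele
    rw [Finset.sum_range_succ]
    have hG0 : G 0 = 0 := by simp [hG]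
    have hGn : G (n + 1) = -((c + n) * (n + 1) * (t (n + 1) * w (n + 1 - (n + 1)))) := by
      simp only [hG]; push_cast; ring
    rw [hG0, hGn] at tele
    have hne : (c + n) * ((n : ℝ) + 1) ≠ 0 := mul_ne_zero (hcm n) (hm n)
    apply mul_left_cancel₀ hne
    have key : (c + n) * ((n : ℝ) + 1) * (∑ k ∈ Finset.range (n + 1), t k * w (n + 1 - k) +
        t (n + 1) * w (n + 1 - (n + 1))) = (c - u + n) * (c - v + n) *
        ((ascPochhammer ℝ n).eval (c - u) * (ascPochhammer ℝ n).eval (c - v) /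
        ((ascPochhammer ℝ n).eval c * (n.factorial : ℝ))) := by linarith
    rw [key]
    have := hcn n; have := hcm n; have := hfac n; have := hm n
    simp only [ascPochhammer_succ_eval, Nat.factorial_succ, Nat.cast_mul, Nat.cast_succ]
    field_simp

/-- **Euler's transformation** `(1 - z) ^ (u + v - c) F(u, v; c; z) = F(c - u, c - v; c; z)`. -/
lemma hypF_mul_one_sub_rpow {u v c z : ℝ} (hu : 0 < u) (hv : 0 < v) (hc : 0 < c)
    (hz : |z| < 1) :
    hypF u v c z * (1 - z) ^ (u + v - c) = hypF (c - u) (c - v) c z := by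
  obtain ⟨hs, hsum⟩ := hasSum_ascPochhammer_div_factorial_mul_pow (c - u - v) hz
  rw [show u + v - c = -(c - u - v) by ring, ← hsum.tsum_eq, hypF, hypF,
    tsum_mul_tsum_eq_tsum_sum_range_of_summable_norm
      (summable_norm_hypergeometric hu hv hc hz) hs]
  refine tsum_congr fun n ↦ ?_
  rw [← sum_range_hypergeometric_mul_ascPochhammer hc, Finset.sum_mul]
  refine Finset.sum_congr rfl fun k hk ↦ ?_
  rw [← Nat.add_sub_of_le (Nat.lt_succ_iff.1 (Finset.mem_range.1 hk)), pow_add]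
  simp only [Nat.add_sub_cancel_left]
  ring

lemma Real.Gamma_add_natCast_eq_ascPochhammer_mul {s : ℝ} (hs : 0 < s) (n : ℕ) :
    Real.Gamma (s + n) = (ascPochhammer ℝ n).eval s * Real.Gamma s := by
  induction n with
  | zero => simp
  | succ n ih =>
    rw [Nat.cast_succ, ← add_assoc, Real.Gamma_add_one (by positivity), ih,
      ascPochhammer_succ_eval]
    ring

lemma factorial_two_mul_eq_ascPochhammer_half (n : ℕ) :
    ((2 * n).factorial : ℝ) = 4 ^ n * ((ascPochhammer ℝ n).eval (1 / 2) * n.factorial) := by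
  induction n with
  | zero => simp
  | succ n ih =>
    rw [show 2 * (n + 1) = 2 * n + 1 + 1 by ring, Nat.factorial_succ, Nat.factorial_succ,
      Nat.factorial_succ, ascPochhammer_succ_eval]
    push_cast
    rw [ih]
    ring

/-- Absolute moments of a centered Gaussian weight. -/
lemma lintegral_abs_rpow_mul_exp_neg_mul_sq {s p : ℝ} (hs : -1 < s) (hp : 0 < p) :
    ∫⁻ x : ℝ, ENNReal.ofReal (|x| ^ s * exp (-p * x ^ 2)) =
      ENNReal.ofReal (p ^ (-(s + 1) / 2) * Real.Gamma ((s + 1) / 2)) := by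
  have hintegrable : Integrable fun x : ℝ ↦ |x| ^ s * exp (-p * x ^ 2) := by
    have h := integrableOn_rpow_mul_exp_neg_mul_sq hp hs
    have h' : IntegrableOn (fun x : ℝ ↦ |x| ^ s * exp (-p * x ^ 2)) (Set.Ioi 0) :=
      h.congr_fun (fun x hx ↦ by simp only [abs_of_pos (Set.mem_Ioi.1 hx)]) measurableSet_Ioi
    rw [← integrableOn_univ, ← Set.Iic_union_Ioi (a := (0 : ℝ)), integrableOn_union]
    refine ⟨?_, h'⟩
    rw [← (Measure.measurePreserving_neg (volume : Measure ℝ)).integrableOn_comp_preimage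
      (Homeomorph.neg ℝ).measurableEmbedding]
    simpa [Function.comp_def, integrableOn_Ici_iff_integrableOn_Ioi] using h'
  rw [← ofReal_integral_eq_lintegral_ofReal hintegrable (ae_of_all _ fun x ↦ by positivity)]
  congr 1
  have h := integral_rpow_mul_exp_neg_mul_rpow (p := 2) two_pos hs hp
  simp only [rpow_two] at h
  have h2 := integral_comp_abs (f := fun x : ℝ ↦ x ^ s * exp (-p * x ^ 2))
  simp only [sq_abs] at h2
  rw [h2, h]
  ring

/-- Reflection of one coordinate turns `exp` into `cosh` in a kernel even in that coordinate. -/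
lemma lintegral_mul_exp_eq_lintegral_mul_cosh {f g : ℝ → ℝ} (hf : Measurable f)
    (hg : Measurable g) (hf0 : ∀ x, 0 ≤ f x) (hg0 : ∀ x, 0 ≤ g x) (hge : ∀ x, g (-x) = g x)
    (r : ℝ) :
    ∫⁻ q : ℝ × ℝ, ENNReal.ofReal (f q.1 * g q.2 * exp (r * q.1 * q.2)) =
      ∫⁻ q : ℝ × ℝ, ENNReal.ofReal (f q.1 * g q.2 * cosh (r * q.1 * q.2)) := by
  have hmp : MeasurePreserving (Prod.map id Neg.neg : ℝ × ℝ → ℝ × ℝ) :=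
    (MeasurePreserving.id volume).prod (Measure.measurePreserving_neg (volume : Measure ℝ))
  have hm (r : ℝ) : Measurable fun q : ℝ × ℝ ↦
      ENNReal.ofReal (f q.1 * g q.2 * exp (r * q.1 * q.2)) := by fun_prop
  have hneg : ∫⁻ q : ℝ × ℝ, ENNReal.ofReal (f q.1 * g q.2 * exp (-r * q.1 * q.2)) =
      ∫⁻ q : ℝ × ℝ, ENNReal.ofReal (f q.1 * g q.2 * exp (r * q.1 * q.2)) := by
    rw [← hmp.lintegral_comp (hm r)]
    simp [hge]
  have hadd : ∫⁻ q : ℝ × ℝ, 2 * ENNReal.ofReal (f q.1 * g q.2 * cosh (r * q.1 * q.2)) =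
      2 * ∫⁻ q : ℝ × ℝ, ENNReal.ofReal (f q.1 * g q.2 * exp (r * q.1 * q.2)) := by
    rw [two_mul (∫⁻ q : ℝ × ℝ, _)]
    nth_rw 2 [← hneg]
    rw [← lintegral_add_left (hm r)]
    refine lintegral_congr fun q ↦ ?_
    have := hf0 q.1; have := hg0 q.2
    rw [← ENNReal.ofReal_add (by positivity) (by positivity),
      show (2 : ENNReal) = ENNReal.ofReal 2 by simp, ← ENNReal.ofReal_mul (by norm_num),
      Real.cosh_eq]
    congr 1
    simp only [neg_mul]
    ring
  rw [lintegral_const_mul' _ _ (by simp)] at hadd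
  exact ((ENNReal.mul_right_inj (by simp) (by simp)).1 hadd).symm

/-- The unnormalized absolute moments of a bivariate Gaussian weight as a power series. -/
lemma integral_abs_rpow_mul_exp_quadratic {a b p q : ℝ} (ha : -1 < a) (hb : -1 < b) (hp : 0 < p)
    (hq : 0 < q) (r : ℝ) :
    ∫ x : ℝ × ℝ, |x.1| ^ a * exp (-p * x.1 ^ 2) * (|x.2| ^ b * exp (-q * x.2 ^ 2)) *
        exp (r * x.1 * x.2) =
      p ^ (-(a + 1) / 2) * q ^ (-(b + 1) / 2) * Real.Gamma ((a + 1) / 2) *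
        Real.Gamma ((b + 1) / 2) *
        hypF ((a + 1) / 2) ((b + 1) / 2) (1 / 2) (r ^ 2 / (4 * p * q)) := by
  have hmom (s p : ℝ) : Measurable fun x : ℝ ↦ |x| ^ s * exp (-p * x ^ 2) := by fun_prop
  rw [integral_eq_lintegral_of_nonneg_ae (ae_of_all _ fun x ↦ by positivity)
      (by fun_prop),
    lintegral_mul_exp_eq_lintegral_mul_cosh (hmom a p) (hmom b q) (fun x ↦ by positivity)
      (fun x ↦ by positivity) (fun x ↦ by simp)]
  have habs (s p x : ℝ) (n : ℕ) (hx : x ≠ 0) :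
      |x| ^ s * exp (-p * x ^ 2) * x ^ (2 * n) = |x| ^ (s + 2 * n) * exp (-p * x ^ 2) := by
    rw [rpow_add (abs_pos.2 hx), show (2 * n : ℝ) = ((2 * n : ℕ) : ℝ) by push_cast; ring,
      rpow_natCast, (even_two_mul n).pow_abs]
    ring
  have hmul (s p : ℝ) (n : ℕ) (hs : -1 < s) (hp : 0 < p) :
      ∫⁻ x : ℝ, ENNReal.ofReal (|x| ^ s * exp (-p * x ^ 2) * x ^ (2 * n)) =
        ENNReal.ofReal (p ^ (-(s + 1) / 2) * Real.Gamma ((s + 1) / 2) *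
          ((ascPochhammer ℝ n).eval ((s + 1) / 2) / p ^ n)) := by
    have hn : (0 : ℝ) ≤ n := n.cast_nonneg
    rw [lintegral_congr_ae (g := fun x : ℝ ↦
        ENNReal.ofReal (|x| ^ (s + 2 * n) * exp (-p * x ^ 2))),
      lintegral_abs_rpow_mul_exp_neg_mul_sq (by linarith) hp]
    · rw [show (s + 2 * n + 1) / 2 = (s + 1) / 2 + n by ring,
        Real.Gamma_add_natCast_eq_ascPochhammer_mul (by linarith),
        show -(s + 2 * n + 1) / 2 = -(s + 1) / 2 - n by ring, rpow_sub hp, rpow_natCast]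
      congr 1
      ring
    · filter_upwards [Measure.ae_ne volume (0 : ℝ)] with x hx
      rw [habs s p x n hx]
  have hterm (n : ℕ) : ∫⁻ x : ℝ × ℝ, ENNReal.ofReal (|x.1| ^ a * exp (-p * x.1 ^ 2) *
        (|x.2| ^ b * exp (-q * x.2 ^ 2)) * ((r * x.1 * x.2) ^ (2 * n) / (2 * n).factorial)) =
      ENNReal.ofReal (p ^ (-(a + 1) / 2) * q ^ (-(b + 1) / 2) * Real.Gamma ((a + 1) / 2) *
        Real.Gamma ((b + 1) / 2) *
        ((ascPochhammer ℝ n).eval ((a + 1) / 2) * (ascPochhammer ℝ n).eval ((b + 1) / 2) /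
          ((ascPochhammer ℝ n).eval (1 / 2) * (n.factorial : ℝ)) * (r ^ 2 / (4 * p * q)) ^ n)) := by
    have hpos (y : ℝ) : 0 ≤ y ^ (2 * n) := (even_two_mul n).pow_nonneg y
    have hA : 0 < (a + 1) / 2 := by linarith
    have hB : 0 < (b + 1) / 2 := by linarith
    have hPA := (ascPochhammer_pos n _ hA).le
    have hPB := (ascPochhammer_pos n _ hB).le
    have hGA := (Real.Gamma_pos_of_pos hA).le
    have hr : 0 ≤ r ^ (2 * n) / ((2 * n).factorial : ℝ) := div_nonneg (hpos r) (by positivity)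
    have hsplit (x : ℝ × ℝ) : ENNReal.ofReal (|x.1| ^ a * exp (-p * x.1 ^ 2) *
        (|x.2| ^ b * exp (-q * x.2 ^ 2)) * ((r * x.1 * x.2) ^ (2 * n) / (2 * n).factorial)) =
        ENNReal.ofReal (r ^ (2 * n) / (2 * n).factorial) *
          (ENNReal.ofReal (|x.1| ^ a * exp (-p * x.1 ^ 2) * x.1 ^ (2 * n)) *
          ENNReal.ofReal (|x.2| ^ b * exp (-q * x.2 ^ 2) * x.2 ^ (2 * n))) := by
      have := hpos x.1
      rw [← ENNReal.ofReal_mul (by positivity), ← ENNReal.ofReal_mul hr]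
      congr 1
      rw [mul_pow, mul_pow]
      ring
    simp_rw [hsplit]
    rw [lintegral_const_mul' _ _ (by simp), Measure.volume_eq_prod, lintegral_prod_mul
      (f := fun x : ℝ ↦ ENNReal.ofReal (|x| ^ a * exp (-p * x ^ 2) * x ^ (2 * n)))
      (g := fun x : ℝ ↦ ENNReal.ofReal (|x| ^ b * exp (-q * x ^ 2) * x ^ (2 * n)))
      (by fun_prop) (by fun_prop), hmul a p n ha hp, hmul b q n hb hq,
      ← ENNReal.ofReal_mul (by positivity), ← ENNReal.ofReal_mul hr,
      factorial_two_mul_eq_ascPochhammer_half, div_pow, mul_pow, mul_pow, pow_mul]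
    congr 1
    have := (ascPochhammer_pos n (1 / 2 : ℝ) (by norm_num)).ne'
    field_simp
  have hcosh (x : ℝ × ℝ) : ENNReal.ofReal (|x.1| ^ a * exp (-p * x.1 ^ 2) *
        (|x.2| ^ b * exp (-q * x.2 ^ 2)) * cosh (r * x.1 * x.2)) =
      ∑' n : ℕ, ENNReal.ofReal (|x.1| ^ a * exp (-p * x.1 ^ 2) *
        (|x.2| ^ b * exp (-q * x.2 ^ 2)) * ((r * x.1 * x.2) ^ (2 * n) / (2 * n).factorial)) := by
    have hs := (Real.hasSum_cosh (r * x.1 * x.2)).mul_left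
      (|x.1| ^ a * exp (-p * x.1 ^ 2) * (|x.2| ^ b * exp (-q * x.2 ^ 2)))
    rw [← hs.tsum_eq, ENNReal.ofReal_tsum_of_nonneg _ hs.summable]
    intro n
    have := (even_two_mul n).pow_nonneg (r * x.1 * x.2)
    positivity
  simp_rw [hcosh]
  rw [lintegral_tsum fun n ↦ by fun_prop]
  simp_rw [hterm]
  rw [ENNReal.tsum_toReal_eq fun n ↦ ENNReal.ofReal_ne_top, hypF, ← tsum_mul_left]
  refine tsum_congr fun n ↦ ENNReal.toReal_ofReal ?_
  have hA : 0 < (a + 1) / 2 := by linarith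
  have hB : 0 < (b + 1) / 2 := by linarith
  have := (ascPochhammer_pos n _ hA).le
  have := (ascPochhammer_pos n _ hB).le
  have := (ascPochhammer_pos n (1 / 2 : ℝ) (by norm_num)).le
  have := (Real.Gamma_pos_of_pos hA).le
  have := (Real.Gamma_pos_of_pos hB).le
  positivity

theorem nabeya_formula (σ₁ σ₂ ρ α₁ α₂ : ℝ)
    (hσ₁ : 0 < σ₁) (hσ₂ : 0 < σ₂) (hρ : ρ ∈ Set.Ioo (-1 : ℝ) 1)
    (hα₁ : -1 < α₁) (hα₂ : -1 < α₂) :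
    E2 σ₁ σ₂ ρ α₁ α₂ =
      2 ^ ((α₁ + α₂) / 2) * σ₁ ^ α₁ * σ₂ ^ α₂ / π *
        Real.Gamma ((α₁ + 1) / 2) * Real.Gamma ((α₂ + 1) / 2) *
        hypF (-α₁ / 2) (-α₂ / 2) (1 / 2) (ρ ^ 2) := by
  have hδ : 0 < 1 - ρ ^ 2 := by nlinarith [hρ.1, hρ.2]
  have hz : |ρ ^ 2| < 1 := by rw [abs_of_nonneg (sq_nonneg ρ)]; linarith
  have hE : E2 σ₁ σ₂ ρ α₁ α₂ = (2 * π * σ₁ * σ₂ * Real.sqrt (1 - ρ ^ 2))⁻¹ *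
      ∫ x : ℝ × ℝ, |x.1| ^ α₁ * exp (-(2 * (1 - ρ ^ 2) * σ₁ ^ 2)⁻¹ * x.1 ^ 2) *
        (|x.2| ^ α₂ * exp (-(2 * (1 - ρ ^ 2) * σ₂ ^ 2)⁻¹ * x.2 ^ 2)) *
        exp (ρ / ((1 - ρ ^ 2) * σ₁ * σ₂) * x.1 * x.2) := by
    rw [E2, ← integral_const_mul]
    refine integral_congr_ae (ae_of_all _ fun x ↦ ?_)
    simp only [gaussDensity2]
    have : -(x.1 ^ 2 / σ₁ ^ 2 - 2 * ρ * x.1 * x.2 / (σ₁ * σ₂) + x.2 ^ 2 / σ₂ ^ 2) /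
        (2 * (1 - ρ ^ 2)) = -(2 * (1 - ρ ^ 2) * σ₁ ^ 2)⁻¹ * x.1 ^ 2 +
        -(2 * (1 - ρ ^ 2) * σ₂ ^ 2)⁻¹ * x.2 ^ 2 +
        ρ / ((1 - ρ ^ 2) * σ₁ * σ₂) * x.1 * x.2 := by
      have := hδ.ne'
      field_simp
      ring
    rw [this, exp_add, exp_add]
    ring
  have hpow (σ α : ℝ) (hσ : 0 < σ) : (2 * (1 - ρ ^ 2) * σ ^ 2)⁻¹ ^ (-(α + 1) / 2) =
      2 ^ (α / 2) * √2 * ((1 - ρ ^ 2) ^ (α / 2) * √(1 - ρ ^ 2)) * (σ ^ α * σ) := by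
    rw [inv_rpow (by positivity), ← rpow_neg (by positivity),
      mul_rpow (by positivity) (by positivity), mul_rpow (by positivity) hδ.le,
      ← rpow_natCast σ 2, ← rpow_mul hσ.le, sqrt_eq_rpow, sqrt_eq_rpow, ← rpow_add two_pos,
      ← rpow_add hδ, ← rpow_add_one hσ.ne']
    congr 2
    · congr 1; ring
    · congr 1; ring
    · push_cast; ring
  have harg : (ρ / ((1 - ρ ^ 2) * σ₁ * σ₂)) ^ 2 /
      (4 * (2 * (1 - ρ ^ 2) * σ₁ ^ 2)⁻¹ * (2 * (1 - ρ ^ 2) * σ₂ ^ 2)⁻¹) = ρ ^ 2 := by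
    have := hδ.ne'
    field_simp
    norm_num
  have hEuler := hypF_mul_one_sub_rpow (u := (α₁ + 1) / 2) (v := (α₂ + 1) / 2) (c := 1 / 2)
    (by linarith) (by linarith) (by norm_num) hz
  rw [show 1 / 2 - (α₁ + 1) / 2 = -α₁ / 2 by ring, show 1 / 2 - (α₂ + 1) / 2 = -α₂ / 2 by ring,
    show (α₁ + 1) / 2 + (α₂ + 1) / 2 - 1 / 2 = α₁ / 2 + α₂ / 2 + 1 / 2 by ring,
    rpow_add hδ, rpow_add hδ, ← sqrt_eq_rpow] at hEuler
  rw [hE, integral_abs_rpow_mul_exp_quadratic hα₁ hα₂ (by positivity) (by positivity), harg,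
    hpow σ₁ α₁ hσ₁, hpow σ₂ α₂ hσ₂, ← hEuler, add_div α₁ α₂, rpow_add two_pos]
  have hs : 0 < √(1 - ρ ^ 2) := sqrt_pos.2 hδ
  have h2 : √2 * √2 = (2 : ℝ) := mul_self_sqrt two_pos.le
  field_simp
  rw [sq, h2]
end
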